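/- arXiv:1908.04096 — 3 statements merged into one kernel-verified Lean document; each statement's English description precedes it below -/
import Mathlib

section
/- Let D be a digraph that is Ore-k-constructible and contains a bidirected complete graph on k vertices as a subdigraph, and let a be an arc of the complement of D (i.e., an ordered pair of distinct vertices of D that is not an arc of D). Then the digraph D + a obtained from D by adding the arc a is also Ore-k-constructible and contains a bidirected complete graph on k vertices. -/
/-- A finite digraph on the vertex type `ℕ`: a finite vertex set together with a
finite set of arcs (ordered pairs of vertices), loopless, without parallel arcs
(but opposite arcs between two vertices are allowed). -/
structure Digr where
  verts : Finset ℕ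
  arcs : Finset (ℕ × ℕ)
  arcs_sub : ∀ a ∈ arcs, a.1 ∈ verts ∧ a.2 ∈ verts
  no_loops : ∀ a ∈ arcs, a.1 ≠ a.2

namespace Digr

/-- `D'` is a subdigraph of `D`. -/
def Sub (D' D : Digr) : Prop := D'.verts ⊆ D.verts ∧ D'.arcs ⊆ D.arcs

/-- An acyclic coloring of `D` with `n` colors: no directed cycle is monochromatic.
A monochromatic directed cycle through `v` is exactly a nontrivial closed walk from `v`
to `v` along arcs whose endpoints always get equal colors. -/
def GoodColoring (D : Digr) (n : ℕ) (φ : ℕ → Fin n) : Prop :=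
  ∀ v, ¬ Relation.TransGen (fun x y => (x, y) ∈ D.arcs ∧ φ x = φ y) v v

/-- `D` admits an acyclic coloring with `n` colors. -/
def Colorable (D : Digr) (n : ℕ) : Prop := ∃ φ : ℕ → Fin n, D.GoodColoring n φ

/-- The dichromatic number of `D`. -/
noncomputable def dichrom (D : Digr) : ℕ := sInf {n | D.Colorable n}

/-- `D` is `k`-critical: its dichromatic number is `k` and every proper subdigraph
has smaller dichromatic number. -/
def Critical (k : ℕ) (D : Digr) : Prop :=
  D.dichrom = k ∧ ∀ D' : Digr, D'.Sub D → D' ≠ D → D'.dichrom < k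

/-- Deletion of a vertex. -/
def delete (D : Digr) (v : ℕ) : Digr where
  verts := D.verts.erase v
  arcs := D.arcs.filter (fun a => a.1 ≠ v ∧ a.2 ≠ v)
  arcs_sub := by
    intro a ha
    rw [Finset.mem_filter] at ha
    obtain ⟨ha, h1, h2⟩ := ha
    have h := D.arcs_sub a ha
    exact ⟨Finset.mem_erase.mpr ⟨h1, h.1⟩, Finset.mem_erase.mpr ⟨h2, h.2⟩⟩
  no_loops := fun a ha => D.no_loops a (Finset.mem_filter.mp ha).1

/-- The subdigraph of `D` induced by a set `S` of vertices. -/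
def induce (D : Digr) (S : Finset ℕ) : Digr where
  verts := D.verts ∩ S
  arcs := D.arcs.filter (fun a => a.1 ∈ S ∧ a.2 ∈ S)
  arcs_sub := by
    intro a ha
    rw [Finset.mem_filter] at ha
    obtain ⟨ha, h1, h2⟩ := ha
    have h := D.arcs_sub a ha
    exact ⟨Finset.mem_inter.mpr ⟨h.1, h1⟩, Finset.mem_inter.mpr ⟨h.2, h2⟩⟩
  no_loops := fun a ha => D.no_loops a (Finset.mem_filter.mp ha).1

/-- Out-neighborhood of `v` in `D`. -/
def outNbrs (D : Digr) (v : ℕ) : Finset ℕ := D.verts.filter (fun y => (v, y) ∈ D.arcs)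

/-- In-neighborhood of `v` in `D`. -/
def inNbrs (D : Digr) (v : ℕ) : Finset ℕ := D.verts.filter (fun x => (x, v) ∈ D.arcs)

/-- Out-degree. -/
def outDeg (D : Digr) (v : ℕ) : ℕ := (D.outNbrs v).card

/-- In-degree. -/
def inDeg (D : Digr) (v : ℕ) : ℕ := (D.inNbrs v).card

/-- `D` is (weakly) connected, i.e. its underlying graph is connected. -/
def Conn (D : Digr) : Prop :=
  ∀ x ∈ D.verts, ∀ y ∈ D.verts,
    Relation.ReflTransGen (fun a b => (a, b) ∈ D.arcs ∨ (b, a) ∈ D.arcs) x y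

/-- `D` is strongly connected. -/
def StronglyConn (D : Digr) : Prop :=
  ∀ x ∈ D.verts, ∀ y ∈ D.verts,
    Relation.ReflTransGen (fun a b => (a, b) ∈ D.arcs) x y

/-- `H` has no separating vertex. -/
def NoSepVertex (H : Digr) : Prop := ∀ v ∈ H.verts, (H.delete v).Conn

/-- `B` is a block of `D`: a maximal connected subdigraph of `D` without a
separating vertex. -/
def IsBlock (B D : Digr) : Prop :=
  B.Sub D ∧ B.Conn ∧ B.NoSepVertex ∧
    ∀ B' : Digr, B'.Sub D → B'.Conn → B'.NoSepVertex → B.Sub B' → B' = B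

/-- `B` is a directed cycle (of length ≥ 2). -/
def IsDirCycle (B : Digr) : Prop :=
  ∃ (n : ℕ) (f : ℕ → ℕ), 2 ≤ n ∧ Set.InjOn f ↑(Finset.range n) ∧
    B.verts = (Finset.range n).image f ∧
    B.arcs = (Finset.range n).image (fun i => (f i, f ((i + 1) % n)))

/-- `B` is a bidirected cycle of length `n`. -/
def IsBidirCycle (B : Digr) (n : ℕ) : Prop :=
  ∃ f : ℕ → ℕ, Set.InjOn f ↑(Finset.range n) ∧
    B.verts = (Finset.range n).image f ∧
    B.arcs = (Finset.range n).image (fun i => (f i, f ((i + 1) % n))) ∪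
      (Finset.range n).image (fun i => (f ((i + 1) % n), f i))

/-- `B` is a bidirected complete graph: every ordered pair of distinct vertices is an arc. -/
def IsBidirComplete (B : Digr) : Prop :=
  B.arcs = (B.verts ×ˢ B.verts).filter (fun a => a.1 ≠ a.2)

/-- `D` contains a bidirected complete graph on `k` vertices as a subdigraph. -/
def ContainsK (k : ℕ) (D : Digr) : Prop :=
  ∃ S : Finset ℕ, S ⊆ D.verts ∧ S.card = k ∧
    ∀ x ∈ S, ∀ y ∈ S, x ≠ y → (x, y) ∈ D.arcs

/-- `D` is the Dirac join of the disjoint digraphs `D1` and `D2`: their union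
together with all arcs in both directions between them. -/
def IsDiracJoin (D D1 D2 : Digr) : Prop :=
  Disjoint D1.verts D2.verts ∧
  D.verts = D1.verts ∪ D2.verts ∧
  D.arcs = D1.arcs ∪ D2.arcs ∪ D1.verts ×ˢ D2.verts ∪ D2.verts ×ˢ D1.verts

/-- `D` is the directed Hajós join `(D1, v1, u1) ▽ (D2, v2, u2)` of the disjoint
digraphs `D1` and `D2`: delete the arcs `u1v1` and `v2u2`, identify `v1` and `v2`
(the merged vertex is represented by `v1`), and add the arc `u1u2`. -/
def IsHajosJoin (D D1 D2 : Digr) (u1 v1 v2 u2 : ℕ) : Prop :=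
  Disjoint D1.verts D2.verts ∧
  (u1, v1) ∈ D1.arcs ∧ (v2, u2) ∈ D2.arcs ∧
  D.verts = D1.verts ∪ D2.verts.erase v2 ∧
  D.arcs = D1.arcs.erase (u1, v1) ∪
      (D2.arcs.erase (v2, u2)).image
        (Prod.map (fun x => if x = v2 then v1 else x) (fun x => if x = v2 then v1 else x)) ∪
      {(u1, u2)}

/-- `D` is the bidirected Hajós join `(D1, v1, u1) ▽̄ (D2, v2, u2)` of the disjoint
digraphs `D1` and `D2`: delete both arcs of the digon between `u1` and `v1` and both
arcs of the digon between `u2` and `v2`, identify `v1` and `v2` (the merged vertex is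
represented by `v1`), and add both arcs `u1u2` and `u2u1`. -/
def IsBidirHajosJoin (D D1 D2 : Digr) (u1 v1 v2 u2 : ℕ) : Prop :=
  Disjoint D1.verts D2.verts ∧
  (u1, v1) ∈ D1.arcs ∧ (v1, u1) ∈ D1.arcs ∧
  (u2, v2) ∈ D2.arcs ∧ (v2, u2) ∈ D2.arcs ∧
  D.verts = D1.verts ∪ D2.verts.erase v2 ∧
  D.arcs = ((D1.arcs.erase (u1, v1)).erase (v1, u1)) ∪
      (((D2.arcs.erase (v2, u2)).erase (u2, v2)).image
        (Prod.map (fun x => if x = v2 then v1 else x) (fun x => if x = v2 then v1 else x))) ∪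
      {(u1, u2), (u2, u1)}

/-- `D'` is obtained from `D` by identifying the non-empty independent set `I`
with the (new) vertex `v`. -/
def IsIdent (D' D : Digr) (I : Finset ℕ) (v : ℕ) : Prop :=
  I.Nonempty ∧ I ⊆ D.verts ∧
  (∀ x ∈ I, ∀ y ∈ I, (x, y) ∉ D.arcs) ∧
  (v ∈ I ∨ v ∉ D.verts) ∧
  D'.verts = (D.verts \ I) ∪ {v} ∧
  D'.arcs = D.arcs.filter (fun a => a.1 ∉ I ∧ a.2 ∉ I) ∪
      (D.arcs.filter (fun a => a.1 ∈ I ∧ a.2 ∉ I)).image (fun a => (v, a.2)) ∪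
      (D.arcs.filter (fun a => a.1 ∉ I ∧ a.2 ∈ I)).image (fun a => (a.1, v))

/-- Isomorphism of digraphs. -/
def Iso (D D' : Digr) : Prop :=
  ∃ f : ℕ → ℕ, Set.BijOn f ↑D.verts ↑D'.verts ∧
    ∀ x ∈ D.verts, ∀ y ∈ D.verts, ((x, y) ∈ D.arcs ↔ (f x, f y) ∈ D'.arcs)

/-- The Hajós-`k`-constructible digraphs: the smallest family of digraphs (closed
under isomorphism) containing the bidirected complete graph on `k` vertices and
closed under directed Hajós joins and identification of independent sets. -/
inductive HajosConstr (k : ℕ) : Digr → Prop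
  | base (D : Digr) : D.verts.card = k → D.IsBidirComplete → HajosConstr k D
  | join (D D1 D2 : Digr) (u1 v1 v2 u2 : ℕ) :
      HajosConstr k D1 → HajosConstr k D2 →
      IsHajosJoin D D1 D2 u1 v1 v2 u2 → HajosConstr k D
  | ident (D' D : Digr) (I : Finset ℕ) (v : ℕ) :
      HajosConstr k D → IsIdent D' D I v → HajosConstr k D'
  | iso (D D' : Digr) : HajosConstr k D → Iso D D' → HajosConstr k D'

/-- `D` is a directed Ore join of the disjoint digraphs `D1` and `D2`: a directed
Hajós join followed by identifying each `w` in a set `A1 ⊆ V(D1 - v1)` with `ι w`,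
where `ι` is a bijection from `A1` onto a subset of `V(D2 - v2)` with `ι u1 ≠ u2`. -/
def IsOreJoin (D D1 D2 : Digr) (u1 v1 v2 u2 : ℕ) : Prop :=
  ∃ (H : Digr) (A1 : Finset ℕ) (ι : ℕ → ℕ),
    IsHajosJoin H D1 D2 u1 v1 v2 u2 ∧
    A1 ⊆ D1.verts.erase v1 ∧
    A1.image ι ⊆ D2.verts.erase v2 ∧
    Set.InjOn ι ↑A1 ∧
    (u1 ∈ A1 → ι u1 ≠ u2) ∧
    D.verts = H.verts.image (fun x => if x ∈ A1 then ι x else x) ∧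
    D.arcs = H.arcs.image
      (Prod.map (fun x => if x ∈ A1 then ι x else x) (fun x => if x ∈ A1 then ι x else x))

/-- `D` is a bidirected Ore join of the disjoint digraphs `D1` and `D2`: a bidirected
Hajós join followed by the same kind of identification as in the directed Ore join. -/
def IsBidirOreJoin (D D1 D2 : Digr) (u1 v1 v2 u2 : ℕ) : Prop :=
  ∃ (H : Digr) (A1 : Finset ℕ) (ι : ℕ → ℕ),
    IsBidirHajosJoin H D1 D2 u1 v1 v2 u2 ∧
    A1 ⊆ D1.verts.erase v1 ∧
    A1.image ι ⊆ D2.verts.erase v2 ∧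
    Set.InjOn ι ↑A1 ∧
    (u1 ∈ A1 → ι u1 ≠ u2) ∧
    D.verts = H.verts.image (fun x => if x ∈ A1 then ι x else x) ∧
    D.arcs = H.arcs.image
      (Prod.map (fun x => if x ∈ A1 then ι x else x) (fun x => if x ∈ A1 then ι x else x))

/-- The Ore-`k`-constructible digraphs: the smallest family of digraphs (closed under
isomorphism) containing the bidirected complete graph on `k` vertices and closed
under directed and bidirected Ore joins. -/
inductive OreConstr (k : ℕ) : Digr → Prop
  | base (D : Digr) : D.verts.card = k → D.IsBidirComplete → OreConstr k D
  | dirJoin (D D1 D2 : Digr) (u1 v1 v2 u2 : ℕ) :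
      OreConstr k D1 → OreConstr k D2 →
      IsOreJoin D D1 D2 u1 v1 v2 u2 → OreConstr k D
  | bidirJoin (D D1 D2 : Digr) (u1 v1 v2 u2 : ℕ) :
      OreConstr k D1 → OreConstr k D2 →
      IsBidirOreJoin D D1 D2 u1 v1 v2 u2 → OreConstr k D
  | iso (D D' : Digr) : OreConstr k D → Iso D D' → OreConstr k D'

/-- The set of low vertices of `D` (for the parameter `k`): the vertices with
out-degree and in-degree both equal to `k - 1`. -/
def lowVerts (D : Digr) (k : ℕ) : Finset ℕ :=
  D.verts.filter (fun v => D.outDeg v = k - 1 ∧ D.inDeg v = k - 1)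

end Digr

namespace Digr

/-- Relabelling along an injective map. -/
def relabel (D : Digr) (c : ℕ → ℕ) (hc : Function.Injective c) : Digr where
  verts := D.verts.image c
  arcs := D.arcs.image (Prod.map c c)
  arcs_sub := by
    intro a ha
    obtain ⟨b, hb, rfl⟩ := Finset.mem_image.mp ha
    have h := D.arcs_sub b hb
    exact ⟨Finset.mem_image_of_mem c h.1, Finset.mem_image_of_mem c h.2⟩
  no_loops := by
    intro a ha
    obtain ⟨b, hb, rfl⟩ := Finset.mem_image.mp ha
    exact fun h => D.no_loops b hb (hc h)

theorem iso_relabel (D : Digr) (c : ℕ → ℕ) (hc : Function.Injective c) :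
    Iso D (D.relabel c hc) := by
  refine ⟨c, ⟨?_, hc.injOn, ?_⟩, ?_⟩
  · intro x hx
    simpa [relabel] using ⟨x, hx, rfl⟩
  · intro x hx
    simpa [relabel] using hx
  · intro x hx y hy
    constructor
    · intro h
      exact Finset.mem_image.mpr ⟨(x, y), h, rfl⟩
    · intro h
      obtain ⟨⟨p, q⟩, hb, h2⟩ := Finset.mem_image.mp h
      simp only [Prod.map_apply, Prod.mk.injEq] at h2
      rw [← hc h2.1, ← hc h2.2]
      exact hb

theorem relabel_iso (D : Digr) (c : ℕ → ℕ) (hc : Function.Injective c) :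
    Iso (D.relabel c hc) D := by
  have hl := Function.leftInverse_invFun hc
  refine ⟨Function.invFun c, ⟨?_, ?_, ?_⟩, ?_⟩
  · intro x hx
    obtain ⟨z, hz, rfl⟩ := Finset.mem_image.mp (Finset.mem_coe.mp hx)
    rw [hl z]; exact hz
  · intro x hx y hy h
    obtain ⟨z, hz, rfl⟩ := Finset.mem_image.mp (Finset.mem_coe.mp hx)
    obtain ⟨w, hw, rfl⟩ := Finset.mem_image.mp (Finset.mem_coe.mp hy)
    rw [hl z, hl w] at h
    rw [h]
  · intro x hx
    exact ⟨c x, Finset.mem_coe.mpr (Finset.mem_image_of_mem c hx), hl x⟩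
  · intro x hx y hy
    obtain ⟨z, hz, rfl⟩ := Finset.mem_image.mp hx
    obtain ⟨w, hw, rfl⟩ := Finset.mem_image.mp hy
    rw [hl z, hl w]
    constructor
    · intro h
      obtain ⟨⟨p, q⟩, hb, h2⟩ := Finset.mem_image.mp h
      simp only [Prod.map_apply, Prod.mk.injEq] at h2
      rw [← hc h2.1, ← hc h2.2]
      exact hb
    · intro h
      exact Finset.mem_image.mpr ⟨(z, w), h, rfl⟩

theorem inj_even : Function.Injective (fun x : ℕ => 2 * x) := by
  intro a b h; simp only at h; omega

theorem inj_odd : Function.Injective (fun x : ℕ => 2 * x + 1) := by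
  intro a b h; simp only at h; omega

/-- Labels of the vertices in the join. -/
def lab (V : Finset ℕ) (v x : ℕ) : ℕ := if x ∈ V ∧ x ≠ v then 2 * x + 1 else 2 * x

theorem lab_inj (V : Finset ℕ) (v : ℕ) : Function.Injective (lab V v) := by
  intro a b h
  unfold lab at h
  split_ifs at h <;> omega

/-- Identification map used in the join. -/
def glue (A : Finset ℕ) (x : ℕ) : ℕ := if x ∈ A then x + 1 else x

theorem glue_even (V1 V2 : Finset ℕ) (v x : ℕ) (hx : x ∈ V1) :
    glue (((V1 ∩ V2).erase v).image (fun x => 2 * x)) (2 * x) = lab V2 v x := by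
  have : 2 * x ∈ ((V1 ∩ V2).erase v).image (fun x => 2 * x) ↔ x ∈ V2 ∧ x ≠ v := by
    simp [hx, and_comm]
  simp only [glue, lab, this]

theorem glue_odd (V1 V2 : Finset ℕ) (v x : ℕ) (hv : v ∈ V1) (hx : x ∈ V2) :
    glue (((V1 ∩ V2).erase v).image (fun x => 2 * x))
      (if 2 * x + 1 = 2 * v + 1 then 2 * v else 2 * x + 1) = lab V2 v x := by
  by_cases h : x = v
  · subst h
    simpa using glue_even V1 V2 x x hv
  · have h1 : ¬ (2 * x + 1 = 2 * v + 1) := by omega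
    have h2 : 2 * x + 1 ∉ ((V1 ∩ V2).erase v).image (fun x => 2 * x) := by
      simp only [Finset.mem_image, not_exists, not_and]
      intro z _; omega
    rw [if_neg h1, glue, if_neg h2, lab, if_pos ⟨hx, h⟩]

/-- The two ingredients needed: the Hajos join before identification. -/
def pre (D1 D2 : Digr) (E1 E2 F : Finset (ℕ × ℕ)) (v : ℕ) (h1 : E1 ⊆ D1.arcs) (h2 : E2 ⊆ D2.arcs)
    (hF : ∀ a ∈ F, a.1 ≠ a.2 ∧ (a.1 ∈ D1.verts.image (fun x => 2 * x) ∪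
      (D2.verts.image (fun x => 2 * x + 1)).erase (2 * v + 1)) ∧
      (a.2 ∈ D1.verts.image (fun x => 2 * x) ∪
      (D2.verts.image (fun x => 2 * x + 1)).erase (2 * v + 1))) (hv : v ∈ D1.verts) : Digr where
  verts := D1.verts.image (fun x => 2 * x) ∪
      (D2.verts.image (fun x => 2 * x + 1)).erase (2 * v + 1)
  arcs := E1.image (Prod.map (fun x => 2 * x) (fun x => 2 * x)) ∪
      (E2.image (Prod.map (fun x => 2 * x + 1) (fun x => 2 * x + 1))).image
      (Prod.map (fun x => if x = 2 * v + 1 then 2 * v else x)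
        (fun x => if x = 2 * v + 1 then 2 * v else x)) ∪ F
  arcs_sub := by
    intro a ha
    simp only [Finset.mem_union] at ha
    rcases ha with (ha | ha) | ha
    · obtain ⟨b, hb, rfl⟩ := Finset.mem_image.mp ha
      have h := D1.arcs_sub b (h1 hb)
      exact ⟨Finset.mem_union_left _ (Finset.mem_image_of_mem _ h.1),
        Finset.mem_union_left _ (Finset.mem_image_of_mem _ h.2)⟩
    · obtain ⟨b', hb', rfl⟩ := Finset.mem_image.mp ha
      obtain ⟨b, hb, rfl⟩ := Finset.mem_image.mp hb'
      have h := D2.arcs_sub b (h2 hb)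
      have key : ∀ x ∈ D2.verts, (if 2 * x + 1 = 2 * v + 1 then 2 * v else 2 * x + 1) ∈
          D1.verts.image (fun x => 2 * x) ∪
            (D2.verts.image (fun x => 2 * x + 1)).erase (2 * v + 1) := by
        intro x hx
        split_ifs with hh
        · exact Finset.mem_union_left _ (Finset.mem_image_of_mem _ hv)
        · exact Finset.mem_union_right _
            (Finset.mem_erase.mpr ⟨hh, Finset.mem_image_of_mem (fun x => 2 * x + 1) hx⟩)
      exact ⟨key _ h.1, key _ h.2⟩
    · exact (hF a ha).2
  no_loops := by
    intro a ha
    simp only [Finset.mem_union] at ha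
    rcases ha with (ha | ha) | ha
    · obtain ⟨b, hb, rfl⟩ := Finset.mem_image.mp ha
      have h := D1.no_loops b (h1 hb)
      simp only [Prod.map_fst, Prod.map_snd]
      omega
    · obtain ⟨b', hb', rfl⟩ := Finset.mem_image.mp ha
      obtain ⟨b, hb, rfl⟩ := Finset.mem_image.mp hb'
      have h := D2.no_loops b (h2 hb)
      simp only [Prod.map_fst, Prod.map_snd]
      split_ifs <;> omega
    · exact (hF a ha).1

theorem lab_verts (V1 V2 : Finset ℕ) (v : ℕ) (hv : v ∈ V1) :
    (V1 ∪ V2).image (lab V2 v) = (V1.image (fun x => 2 * x) ∪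
      (V2.image (fun x => 2 * x + 1)).erase (2 * v + 1)).image
      (glue (((V1 ∩ V2).erase v).image (fun x => 2 * x))) := by
  ext z
  simp only [Finset.mem_image, Finset.mem_union, Finset.mem_erase]
  constructor
  · rintro ⟨x, hx, rfl⟩
    by_cases h1 : x ∈ V1
    · exact ⟨2 * x, Or.inl ⟨x, h1, rfl⟩, glue_even V1 V2 v x h1⟩
    · have h2 : x ∈ V2 := hx.resolve_left h1
      have hxv : x ≠ v := fun h => h1 (h ▸ hv)
      have hne : 2 * x + 1 ≠ 2 * v + 1 := by omega
      refine ⟨2 * x + 1, Or.inr ⟨hne, x, h2, rfl⟩, ?_⟩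
      have := glue_odd V1 V2 v x hv h2
      rwa [if_neg hne] at this
  · rintro ⟨w, (⟨x, hx, rfl⟩ | ⟨hne, x, hx, rfl⟩), rfl⟩
    · exact ⟨x, Or.inl hx, (glue_even V1 V2 v x hx).symm⟩
    · refine ⟨x, Or.inr hx, ?_⟩
      have := glue_odd V1 V2 v x hv hx
      rw [if_neg hne] at this
      exact this.symm

theorem lab_arcs (D1 D2 : Digr) (E1 E2 F G : Finset (ℕ × ℕ)) (v : ℕ) (h1 : E1 ⊆ D1.arcs)
    (h2 : E2 ⊆ D2.arcs) (hv : v ∈ D1.verts)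
    (hG : G.image (Prod.map (lab D2.verts v) (lab D2.verts v)) =
      F.image (Prod.map (glue (((D1.verts ∩ D2.verts).erase v).image (fun x => 2 * x)))
        (glue (((D1.verts ∩ D2.verts).erase v).image (fun x => 2 * x))))) :
    (E1 ∪ E2 ∪ G).image (Prod.map (lab D2.verts v) (lab D2.verts v)) =
    (E1.image (Prod.map (fun x => 2 * x) (fun x => 2 * x)) ∪
      (E2.image (Prod.map (fun x => 2 * x + 1) (fun x => 2 * x + 1))).image
      (Prod.map (fun x => if x = 2 * v + 1 then 2 * v else x)
        (fun x => if x = 2 * v + 1 then 2 * v else x)) ∪ F).image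
      (Prod.map (glue (((D1.verts ∩ D2.verts).erase v).image (fun x => 2 * x)))
        (glue (((D1.verts ∩ D2.verts).erase v).image (fun x => 2 * x)))) := by
  simp only [Finset.image_union, hG, Finset.image_image]
  congr 2
  · apply Finset.image_congr
    intro a ha
    have h := D1.arcs_sub a (h1 ha)
    simp only [Function.comp, Prod.map]
    rw [glue_even _ _ _ _ h.1, glue_even _ _ _ _ h.2]
  · apply Finset.image_congr
    intro a ha
    have h := D2.arcs_sub a (h2 ha)
    simp only [Function.comp, Prod.map]
    rw [glue_odd _ _ _ _ hv h.1, glue_odd _ _ _ _ hv h.2]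

theorem disj_even_odd (V1 V2 : Finset ℕ) :
    Disjoint (V1.image (fun x => 2 * x)) (V2.image (fun x => 2 * x + 1)) := by
  rw [Finset.disjoint_left]
  intro a ha hb
  obtain ⟨x, _, rfl⟩ := Finset.mem_image.mp ha
  obtain ⟨y, _, h⟩ := Finset.mem_image.mp hb
  omega

theorem A1_sub (V1 V2 : Finset ℕ) (v : ℕ) :
    ((V1 ∩ V2).erase v).image (fun x => 2 * x) ⊆ (V1.image (fun x => 2 * x)).erase (2 * v) := by
  intro a ha
  obtain ⟨x, hx, rfl⟩ := Finset.mem_image.mp ha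
  simp only [Finset.mem_erase, Finset.mem_inter] at hx
  refine Finset.mem_erase.mpr ⟨?_, Finset.mem_image_of_mem _ hx.2.1⟩
  have := hx.1
  omega

theorem A1_image_sub (V1 V2 : Finset ℕ) (v : ℕ) :
    (((V1 ∩ V2).erase v).image (fun x => 2 * x)).image (fun x => x + 1) ⊆
      (V2.image (fun x => 2 * x + 1)).erase (2 * v + 1) := by
  intro a ha
  obtain ⟨b, hb, rfl⟩ := Finset.mem_image.mp ha
  obtain ⟨x, hx, rfl⟩ := Finset.mem_image.mp hb
  simp only [Finset.mem_erase, Finset.mem_inter] at hx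
  refine Finset.mem_erase.mpr ⟨?_, Finset.mem_image.mpr ⟨x, hx.2.2, rfl⟩⟩
  have := hx.1
  omega

theorem OreConstr.dir {k : ℕ} {D1 D2 : Digr} (hD1 : OreConstr k D1) (hD2 : OreConstr k D2)
    (u1 v u2 : ℕ) (ha1 : (u1, v) ∈ D1.arcs) (ha2 : (v, u2) ∈ D2.arcs) (hne : u1 ≠ u2)
    (D : Digr) (hV : D.verts = D1.verts ∪ D2.verts)
    (hA : ∀ p q, (p, q) ∈ D.arcs ↔ ((p, q) ∈ D1.arcs ∧ ¬ (p = u1 ∧ q = v)) ∨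
      ((p, q) ∈ D2.arcs ∧ ¬ (p = v ∧ q = u2)) ∨ (p = u1 ∧ q = u2)) : OreConstr k D := by
  have hu1 := (D1.arcs_sub _ ha1).1
  have hv := (D1.arcs_sub _ ha1).2
  have hv2 := (D2.arcs_sub _ ha2).1
  have hu2 := (D2.arcs_sub _ ha2).2
  have hvu2 := D2.no_loops _ ha2
  simp only at hu1 hv hv2 hu2 hvu2
  have hE : D.arcs = D1.arcs.erase (u1, v) ∪ D2.arcs.erase (v, u2) ∪ {(u1, u2)} := by
    ext ⟨p, q⟩
    rw [hA]
    simp only [Finset.mem_union, Finset.mem_erase, Finset.mem_singleton, Prod.mk.injEq, ne_eq]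
    tauto
  have hFin : 2 * u2 + 1 ∈ D1.verts.image (fun x => 2 * x) ∪
      (D2.verts.image (fun x => 2 * x + 1)).erase (2 * v + 1) :=
    Finset.mem_union_right _ (Finset.mem_erase.mpr
      ⟨by omega, Finset.mem_image.mpr ⟨u2, hu2, rfl⟩⟩)
  have hFin1 : 2 * u1 ∈ D1.verts.image (fun x => 2 * x) ∪
      (D2.verts.image (fun x => 2 * x + 1)).erase (2 * v + 1) :=
    Finset.mem_union_left _ (Finset.mem_image_of_mem _ hu1)
  have g1 := glue_even D1.verts D2.verts v u1 hu1
  have g2 := glue_odd D1.verts D2.verts v u2 hv hu2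
  rw [if_neg (by omega)] at g2
  refine OreConstr.iso _ _ ?_ (relabel_iso D (lab D2.verts v) (lab_inj _ _))
  refine OreConstr.dirJoin _ (D1.relabel _ inj_even) (D2.relabel _ inj_odd)
    (2 * u1) (2 * v) (2 * v + 1) (2 * u2 + 1)
    (OreConstr.iso _ _ hD1 (iso_relabel _ _ _)) (OreConstr.iso _ _ hD2 (iso_relabel _ _ _)) ?_
  refine ⟨pre D1 D2 (D1.arcs.erase (u1, v)) (D2.arcs.erase (v, u2)) {(2 * u1, 2 * u2 + 1)} v
    (Finset.erase_subset _ _) (Finset.erase_subset _ _) ?_ hv,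
    ((D1.verts ∩ D2.verts).erase v).image (fun x => 2 * x), fun x => x + 1,
    ⟨disj_even_odd _ _, ?_, ?_, rfl, ?_⟩, A1_sub _ _ _, A1_image_sub _ _ _, ?_, ?_, ?_, ?_⟩
  · intro a ha
    rw [Finset.mem_singleton] at ha
    subst ha
    exact ⟨by simp only; omega, hFin1, hFin⟩
  · exact Finset.mem_image.mpr ⟨_, ha1, rfl⟩
  · exact Finset.mem_image.mpr ⟨_, ha2, rfl⟩
  · simp only [pre, relabel]
    rw [Finset.image_erase (inj_even.prodMap inj_even), Finset.image_erase (inj_odd.prodMap inj_odd)]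
    rfl
  · intro a _ b _ h
    simpa using h
  · intro _; simp only; omega
  · change D.verts.image (lab D2.verts v) = _
    rw [hV]
    exact lab_verts _ _ _ hv
  · change D.arcs.image _ = _
    rw [hE]
    refine lab_arcs D1 D2 _ _ _ _ v (Finset.erase_subset _ _) (Finset.erase_subset _ _) hv ?_
    simp only [Finset.image_singleton, Prod.map_apply, g1, g2]

theorem OreConstr.bidir {k : ℕ} {D1 D2 : Digr} (hD1 : OreConstr k D1) (hD2 : OreConstr k D2)
    (u1 v u2 : ℕ) (ha1 : (u1, v) ∈ D1.arcs) (ha1' : (v, u1) ∈ D1.arcs)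
    (ha2 : (v, u2) ∈ D2.arcs) (ha2' : (u2, v) ∈ D2.arcs) (hne : u1 ≠ u2)
    (D : Digr) (hV : D.verts = D1.verts ∪ D2.verts)
    (hA : ∀ p q, (p, q) ∈ D.arcs ↔
      ((p, q) ∈ D1.arcs ∧ ¬ (p = u1 ∧ q = v) ∧ ¬ (p = v ∧ q = u1)) ∨
      ((p, q) ∈ D2.arcs ∧ ¬ (p = v ∧ q = u2) ∧ ¬ (p = u2 ∧ q = v)) ∨
      (p = u1 ∧ q = u2) ∨ (p = u2 ∧ q = u1)) : OreConstr k D := by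
  have hu1 := (D1.arcs_sub _ ha1).1
  have hv := (D1.arcs_sub _ ha1).2
  have hv2 := (D2.arcs_sub _ ha2).1
  have hu2 := (D2.arcs_sub _ ha2).2
  have hvu2 := D2.no_loops _ ha2
  simp only at hu1 hv hv2 hu2 hvu2
  have hE : D.arcs = (D1.arcs.erase (u1, v)).erase (v, u1) ∪
      (D2.arcs.erase (v, u2)).erase (u2, v) ∪ {(u1, u2), (u2, u1)} := by
    ext ⟨p, q⟩
    rw [hA]
    simp only [Finset.mem_union, Finset.mem_erase, Finset.mem_singleton, Finset.mem_insert,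
      Prod.mk.injEq, ne_eq]
    grind
  have hFin : 2 * u2 + 1 ∈ D1.verts.image (fun x => 2 * x) ∪
      (D2.verts.image (fun x => 2 * x + 1)).erase (2 * v + 1) :=
    Finset.mem_union_right _ (Finset.mem_erase.mpr
      ⟨by omega, Finset.mem_image.mpr ⟨u2, hu2, rfl⟩⟩)
  have hFin1 : 2 * u1 ∈ D1.verts.image (fun x => 2 * x) ∪
      (D2.verts.image (fun x => 2 * x + 1)).erase (2 * v + 1) :=
    Finset.mem_union_left _ (Finset.mem_image_of_mem _ hu1)
  have g1 := glue_even D1.verts D2.verts v u1 hu1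
  have g2 := glue_odd D1.verts D2.verts v u2 hv hu2
  rw [if_neg (by omega)] at g2
  have s1 : (D1.arcs.erase (u1, v)).erase (v, u1) ⊆ D1.arcs :=
    (Finset.erase_subset _ _).trans (Finset.erase_subset _ _)
  have s2 : (D2.arcs.erase (v, u2)).erase (u2, v) ⊆ D2.arcs :=
    (Finset.erase_subset _ _).trans (Finset.erase_subset _ _)
  refine OreConstr.iso _ _ ?_ (relabel_iso D (lab D2.verts v) (lab_inj _ _))
  refine OreConstr.bidirJoin _ (D1.relabel _ inj_even) (D2.relabel _ inj_odd)
    (2 * u1) (2 * v) (2 * v + 1) (2 * u2 + 1)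
    (OreConstr.iso _ _ hD1 (iso_relabel _ _ _)) (OreConstr.iso _ _ hD2 (iso_relabel _ _ _)) ?_
  refine ⟨pre D1 D2 _ _ {(2 * u1, 2 * u2 + 1), (2 * u2 + 1, 2 * u1)} v s1 s2 ?_ hv,
    ((D1.verts ∩ D2.verts).erase v).image (fun x => 2 * x), fun x => x + 1,
    ⟨disj_even_odd _ _, ?_, ?_, ?_, ?_, rfl, ?_⟩, A1_sub _ _ _, A1_image_sub _ _ _, ?_, ?_, ?_, ?_⟩
  · intro a ha
    rw [Finset.mem_insert, Finset.mem_singleton] at ha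
    rcases ha with rfl | rfl
    · exact ⟨by simp only; omega, hFin1, hFin⟩
    · exact ⟨by simp only; omega, hFin, hFin1⟩
  · exact Finset.mem_image.mpr ⟨_, ha1, rfl⟩
  · exact Finset.mem_image.mpr ⟨_, ha1', rfl⟩
  · exact Finset.mem_image.mpr ⟨_, ha2', rfl⟩
  · exact Finset.mem_image.mpr ⟨_, ha2, rfl⟩
  · simp only [pre, relabel]
    rw [Finset.image_erase (inj_even.prodMap inj_even), Finset.image_erase (inj_odd.prodMap inj_odd),
      Finset.image_erase (inj_even.prodMap inj_even), Finset.image_erase (inj_odd.prodMap inj_odd)]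
    rfl
  · intro a _ b _ h
    simpa using h
  · intro _; simp only; omega
  · change D.verts.image (lab D2.verts v) = _
    rw [hV]
    exact lab_verts _ _ _ hv
  · change D.arcs.image _ = _
    rw [hE]
    refine lab_arcs D1 D2 _ _ _ _ v s1 s2 hv ?_
    simp only [Finset.image_insert, Finset.image_singleton, Prod.map_apply, g1, g2]

open Classical in
/-- Digraph on `V` given by a relation. -/
noncomputable def ofRel (V : Finset ℕ) (r : ℕ → ℕ → Prop) : Digr where
  verts := V
  arcs := (V ×ˢ V).filter (fun a => a.1 ≠ a.2 ∧ r a.1 a.2)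
  arcs_sub := by
    intro a ha
    simpa using Finset.mem_product.mp (Finset.mem_filter.mp ha).1
  no_loops := fun a ha => (Finset.mem_filter.mp ha).2.1

theorem mem_ofRel (V : Finset ℕ) (r : ℕ → ℕ → Prop) (p q : ℕ) :
    (p, q) ∈ (ofRel V r).arcs ↔ p ∈ V ∧ q ∈ V ∧ p ≠ q ∧ r p q := by
  simp [ofRel, and_assoc]

/-- `D` plus the arc `xy`. -/
noncomputable def plus (D : Digr) (x y : ℕ) : Digr :=
  ofRel D.verts (fun p q => (p, q) ∈ D.arcs ∨ (p = x ∧ q = y))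

theorem mem_plus {D : Digr} {x y : ℕ} (hx : x ∈ D.verts) (hy : y ∈ D.verts) (hxy : x ≠ y)
    (p q : ℕ) : (p, q) ∈ (D.plus x y).arcs ↔ (p, q) ∈ D.arcs ∨ (p = x ∧ q = y) := by
  rw [plus, mem_ofRel]
  constructor
  · exact fun h => h.2.2.2
  · rintro (h | ⟨rfl, rfl⟩)
    · exact ⟨(D.arcs_sub _ h).1, (D.arcs_sub _ h).2, D.no_loops _ h, Or.inl h⟩
    · exact ⟨hx, hy, hxy, Or.inr ⟨rfl, rfl⟩⟩

theorem ext' {D D' : Digr} (hV : D.verts = D'.verts)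
    (hA : ∀ p q, (p, q) ∈ D.arcs ↔ (p, q) ∈ D'.arcs) : D = D' := by
  have : D.arcs = D'.arcs := by ext ⟨p, q⟩; exact hA p q
  cases D; cases D'; simp_all

theorem plus_trans {k : ℕ} {D : Digr} {x v y : ℕ} (hx : x ∈ D.verts) (hv : v ∈ D.verts)
    (hy : y ∈ D.verts) (hxv : x ≠ v) (hvy : v ≠ y) (hxy : x ≠ y)
    (h1 : OreConstr k (D.plus x v)) (h2 : OreConstr k (D.plus v y)) :
    OreConstr k (D.plus x y) := by
  refine OreConstr.dir h1 h2 x v y ?_ ?_ hxy _ ?_ ?_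
  · rw [mem_plus hx hv hxv]; exact Or.inr ⟨rfl, rfl⟩
  · rw [mem_plus hv hy hvy]; exact Or.inr ⟨rfl, rfl⟩
  · simp [plus, ofRel]
  · intro p q
    rw [mem_plus hx hv hxv, mem_plus hv hy hvy, mem_plus hx hy hxy]
    grind

theorem plus_self {k : ℕ} {D : Digr} {x y : ℕ} (h : OreConstr k D) (hxy : (x, y) ∈ D.arcs) :
    OreConstr k (D.plus x y) := by
  have : D.plus x y = D := by
    refine ext' rfl fun p q => ?_
    rw [mem_plus (D.arcs_sub _ hxy).1 (D.arcs_sub _ hxy).2 (D.no_loops _ hxy)]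
    grind
  rw [this]; exact h

theorem plus_path {k : ℕ} {D : Digr} {x v y : ℕ} (h : OreConstr k D) (hxy : x ≠ y)
    (h1 : (x, v) ∈ D.arcs) (h2 : (v, y) ∈ D.arcs) : OreConstr k (D.plus x y) :=
  plus_trans (D.arcs_sub _ h1).1 (D.arcs_sub _ h1).2 (D.arcs_sub _ h2).2 (D.no_loops _ h1)
    (D.no_loops _ h2) hxy (plus_self h h1) (plus_self h h2)

/-- complete digraph -/
noncomputable def comp (S : Finset ℕ) : Digr := ofRel S (fun _ _ => True)

theorem mem_comp (S : Finset ℕ) (p q : ℕ) :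
    (p, q) ∈ (comp S).arcs ↔ p ∈ S ∧ q ∈ S ∧ p ≠ q := by
  simp [comp, mem_ofRel]

theorem ore_comp (S : Finset ℕ) : OreConstr S.card (comp S) := by
  refine OreConstr.base _ rfl ?_
  unfold IsBidirComplete
  ext ⟨p, q⟩
  rw [mem_comp]
  simp [comp, ofRel, and_assoc]

/-- `K_S` plus a vertex `x` with arcs to `N` and from `N'`. -/
noncomputable def att (S : Finset ℕ) (x : ℕ) (N N' : ℕ → Prop) : Digr :=
  ofRel (insert x S) (fun p q => (p ∈ S ∧ q ∈ S) ∨ (p = x ∧ N q) ∨ (q = x ∧ N' p))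

theorem mem_att {S : Finset ℕ} {x : ℕ} {N N' : ℕ → Prop} (hx : x ∉ S)
    (p q : ℕ) : (p, q) ∈ (att S x N N').arcs ↔
      (p ∈ S ∧ q ∈ S ∧ p ≠ q) ∨ (p = x ∧ q ∈ S ∧ N q) ∨ (q = x ∧ p ∈ S ∧ N' p) := by
  rw [att, mem_ofRel]
  simp only [Finset.mem_insert]
  grind

theorem ore_full (S : Finset ℕ) (x a b : ℕ) (hx : x ∉ S) (ha : a ∈ S) (hb : b ∈ S) (hab : a ≠ b) :
    OreConstr S.card (att S x (fun _ => True) (fun _ => True)) := by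
  have hxa : x ≠ a := fun h => hx (h ▸ ha)
  have hxb : x ≠ b := fun h => hx (h ▸ hb)
  have hcard : (insert x (S.erase b)).card = S.card := by
    rw [Finset.card_insert_of_notMem (by simp [hx]), Finset.card_erase_of_mem hb]
    have := Finset.card_pos.mpr ⟨b, hb⟩
    omega
  have h2 := ore_comp (insert x (S.erase b))
  rw [hcard] at h2
  set E : Digr := ofRel (insert x S) (fun p q => ¬ (p = b ∧ q = a) ∧ ¬ (p = a ∧ q = x) ∧
    ¬ (p = x ∧ q = b)) with hE
  have hEo : OreConstr S.card E := by
    refine OreConstr.dir (ore_comp S) h2 b a x ?_ ?_ hxb.symm _ ?_ ?_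
    · rw [mem_comp]; exact ⟨hb, ha, hab.symm⟩
    · rw [mem_comp]; simp [ha, hab, hxa.symm]
    · ext z
      simp only [hE, comp, ofRel, Finset.mem_union, Finset.mem_insert, Finset.mem_erase]
      grind
    · intro p q
      rw [hE, mem_ofRel, mem_comp, mem_comp]
      simp only [Finset.mem_insert, Finset.mem_erase]
      grind
  have mE : ∀ p q, (p, q) ∈ E.arcs ↔ _ := mem_ofRel _ _
  have vx : x ∈ E.verts := Finset.mem_insert_self _ _
  have va : a ∈ E.verts := Finset.mem_insert_of_mem ha
  have vb : b ∈ E.verts := Finset.mem_insert_of_mem hb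
  have h3 : OreConstr S.card (E.plus b a) := by
    refine plus_path (v := x) hEo hab.symm ?_ ?_ <;> rw [mE] <;> simp only [Finset.mem_insert] <;> grind
  have m3 := mem_plus vb va hab.symm
  have h4 : OreConstr S.card ((E.plus b a).plus a x) := by
    refine plus_path (v := b) h3 hxa.symm ?_ ?_ <;> rw [m3, mE] <;>
      simp only [Finset.mem_insert] <;> grind
  have m4 := mem_plus (D := E.plus b a) va vx hxa.symm
  have h5 : OreConstr S.card (((E.plus b a).plus a x).plus x b) := by
    refine plus_path (v := a) h4 hxb ?_ ?_ <;> rw [m4, m3, mE] <;>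
      simp only [Finset.mem_insert] <;> grind
  have m5 := mem_plus (D := (E.plus b a).plus a x) vx vb hxb
  have : ((E.plus b a).plus a x).plus x b = att S x (fun _ => True) (fun _ => True) := by
    refine ext' rfl fun p q => ?_
    rw [m5, m4, m3, mE, mem_att hx]
    simp only [Finset.mem_insert]
    grind
  rw [← this]; exact h5

theorem ore_del (S : Finset ℕ) (x a b : ℕ) (hx : x ∉ S) (ha : a ∈ S) (hb : b ∈ S) (hab : a ≠ b)
    (T : Finset ℕ) (haT : a ∉ T) :
    OreConstr S.card (att S x (fun z => z ∉ T) (fun z => z ∉ T)) := by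
  induction T using Finset.induction_on with
  | empty => simpa using ore_full S x a b hx ha hb hab
  | insert t T ht ih =>
    have hta : t ≠ a := fun h => haT (by simp [h])
    have haT' : a ∉ T := fun h => haT (by simp [h])
    have ih := ih haT'
    by_cases htS : t ∈ S
    · have hxt : x ≠ t := fun h => hx (h ▸ htS)
      have hxa : x ≠ a := fun h => hx (h ▸ ha)
      refine OreConstr.bidir ih (ore_comp S) x t a ?_ ?_ ?_ ?_ hxa _ ?_ ?_
      · rw [mem_att hx]; grind
      · rw [mem_att hx]; grind
      · rw [mem_comp]; grind
      · rw [mem_comp]; grind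
      · ext z
        simp only [att, comp, ofRel, Finset.mem_union, Finset.mem_insert]
        tauto
      · intro p q
        rw [mem_att hx, mem_att hx, mem_comp]
        simp only [Finset.mem_insert]
        grind
    · have : att S x (fun z => z ∉ insert t T) (fun z => z ∉ insert t T) =
          att S x (fun z => z ∉ T) (fun z => z ∉ T) := by
        refine ext' rfl fun p q => ?_
        rw [mem_att hx, mem_att hx]
        simp only [Finset.mem_insert]
        grind
      rw [this]; exact ih

theorem ore_pendant (S : Finset ℕ) (x a b : ℕ) (hx : x ∉ S) (ha : a ∈ S) (hb : b ∈ S)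
    (hab : a ≠ b) : OreConstr S.card (att S x (fun z => z = a) (fun z => z = a)) := by
  have h := ore_del S x a b hx ha hb hab (S.erase a) (by simp)
  have : att S x (fun z => z ∉ S.erase a) (fun z => z ∉ S.erase a) =
      att S x (fun z => z = a) (fun z => z = a) := by
    refine ext' rfl fun p q => ?_
    rw [mem_att hx, mem_att hx]
    simp only [Finset.mem_erase]
    grind
  rw [← this]; exact h

theorem ore_arc_out (S : Finset ℕ) (x a b : ℕ) (hx : x ∉ S) (ha : a ∈ S) (hb : b ∈ S)
    (hab : a ≠ b) : OreConstr S.card (att S x (fun z => z = b) (fun _ => False)) := by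
  have hxa : x ≠ a := fun h => hx (h ▸ ha)
  have hxb : x ≠ b := fun h => hx (h ▸ hb)
  have h1 := ore_pendant S x b a hx hb ha hab.symm
  have h0 := ore_pendant S x a b hx ha hb hab
  have h2 : OreConstr S.card ((att S x (fun z => z = a) (fun z => z = a)).plus x b) := by
    refine plus_path (v := a) h0 hxb ?_ ?_ <;> rw [mem_att hx] <;> grind
  have m2 := mem_plus (D := att S x (fun z => z = a) (fun z => z = a))
    (Finset.mem_insert_self _ _) (Finset.mem_insert_of_mem hb) hxb
  refine OreConstr.bidir h1 h2 b x a ?_ ?_ ?_ ?_ hab.symm _ ?_ ?_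
  · rw [mem_att hx]; grind
  · rw [mem_att hx]; grind
  · rw [m2, mem_att hx]; grind
  · rw [m2, mem_att hx]; grind
  · simp [att, plus, ofRel]
  · intro p q
    rw [m2, mem_att hx, mem_att hx, mem_att hx]
    grind

theorem ore_arc_in (S : Finset ℕ) (x a b : ℕ) (hx : x ∉ S) (ha : a ∈ S) (hb : b ∈ S)
    (hab : a ≠ b) : OreConstr S.card (att S x (fun _ => False) (fun z => z = b)) := by
  have hxa : x ≠ a := fun h => hx (h ▸ ha)
  have hxb : x ≠ b := fun h => hx (h ▸ hb)
  have h1 := ore_pendant S x b a hx hb ha hab.symm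
  have h0 := ore_pendant S x a b hx ha hb hab
  have h2 : OreConstr S.card ((att S x (fun z => z = a) (fun z => z = a)).plus b x) := by
    refine plus_path (v := a) h0 hxb.symm ?_ ?_ <;> rw [mem_att hx] <;> grind
  have m2 := mem_plus (D := att S x (fun z => z = a) (fun z => z = a))
    (Finset.mem_insert_of_mem hb) (Finset.mem_insert_self _ _) hxb.symm
  refine OreConstr.bidir h1 h2 b x a ?_ ?_ ?_ ?_ hab.symm _ ?_ ?_
  · rw [mem_att hx]; grind
  · rw [mem_att hx]; grind
  · rw [m2, mem_att hx]; grind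
  · rw [m2, mem_att hx]; grind
  · simp [att, plus, ofRel]
  · intro p q
    rw [m2, mem_att hx, mem_att hx, mem_att hx]
    grind

theorem plus_out {D : Digr} {S : Finset ℕ} (h : OreConstr S.card D) (hS : S ⊆ D.verts)
    (hK : ∀ x ∈ S, ∀ y ∈ S, x ≠ y → (x, y) ∈ D.arcs) {x a b : ℕ} (hxD : x ∈ D.verts)
    (hx : x ∉ S) (ha : a ∈ S) (hb : b ∈ S) (hab : a ≠ b) : OreConstr S.card (D.plus x b) := by
  have hxb : x ≠ b := fun h => hx (h ▸ hb)
  have h1 := ore_arc_out S x b a hx hb ha hab.symm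
  refine OreConstr.dir h1 h x a b ?_ (hK a ha b hb hab) hxb _ ?_ ?_
  · rw [mem_att hx]; grind
  · ext z
    simp only [att, plus, ofRel, Finset.mem_union, Finset.mem_insert]
    grind
  · intro p q
    rw [mem_plus hxD (hS hb) hxb, mem_att hx]
    grind

theorem plus_in {D : Digr} {S : Finset ℕ} (h : OreConstr S.card D) (hS : S ⊆ D.verts)
    (hK : ∀ x ∈ S, ∀ y ∈ S, x ≠ y → (x, y) ∈ D.arcs) {x a b : ℕ} (hxD : x ∈ D.verts)
    (hx : x ∉ S) (ha : a ∈ S) (hb : b ∈ S) (hab : a ≠ b) : OreConstr S.card (D.plus b x) := by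
  have hxb : x ≠ b := fun h => hx (h ▸ hb)
  have h1 := ore_arc_in S x b a hx hb ha hab.symm
  refine OreConstr.dir h h1 b a x (hK b hb a ha hab.symm) ?_ hxb.symm _ ?_ ?_
  · rw [mem_att hx]; grind
  · ext z
    simp only [att, plus, ofRel, Finset.mem_union, Finset.mem_insert]
    grind
  · intro p q
    rw [mem_plus (hS hb) hxD hxb.symm, mem_att hx]
    grind

theorem arc_card {D : Digr} {a : ℕ × ℕ} (h : a ∈ D.arcs) : 1 < D.verts.card :=
  Finset.one_lt_card.mpr ⟨a.1, (D.arcs_sub _ h).1, a.2, (D.arcs_sub _ h).2, D.no_loops _ h⟩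

theorem small {k : ℕ} (hk : k ≤ 1) {D : Digr} (h : OreConstr k D) : D.verts.card ≤ 1 := by
  induction h with
  | base D h _ => omega
  | dirJoin D D1 D2 u1 v1 v2 u2 _ _ hj ih _ =>
    obtain ⟨H, A, i, hj, _⟩ := hj
    have := arc_card hj.2.1
    omega
  | bidirJoin D D1 D2 u1 v1 v2 u2 _ _ hj ih _ =>
    obtain ⟨H, A, i, hj, _⟩ := hj
    have := arc_card hj.2.1
    omega
  | iso D D' _ hi ih =>
    obtain ⟨f, hf, _⟩ := hi
    have : D'.verts = D.verts.image f := by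
      rw [← Finset.coe_inj, Finset.coe_image, hf.image_eq]
    rw [this]
    exact Finset.card_image_le.trans ih

end Digr

open Digr in
/-- If `D` is Ore-`k`-constructible and contains a bidirected complete
graph on `k` vertices, and `a = (x, y)` is an arc of the complement of `D`, then the
digraph obtained from `D` by adding the arc `a` is also Ore-`k`-constructible and
contains a bidirected complete graph on `k` vertices. -/
theorem oreConstructible_add_arc (k : ℕ) (D : Digr)
    (hOre : OreConstr k D) (hK : ContainsK k D)
    (x y : ℕ) (hx : x ∈ D.verts) (hy : y ∈ D.verts) (hxy : x ≠ y)
    (hna : (x, y) ∉ D.arcs)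
    (D' : Digr) (hverts : D'.verts = D.verts) (harcs : D'.arcs = insert (x, y) D.arcs) :
    OreConstr k D' ∧ ContainsK k D' := by
  obtain ⟨S, hS, hcard, hK⟩ := hK
  refine ⟨?_, S, hverts ▸ hS, hcard, fun p hp q hq hpq => ?_⟩
  swap
  · rw [harcs]; exact Finset.mem_insert_of_mem (hK p hp q hq hpq)
  have hD' : D' = D.plus x y := by
    refine ext' hverts fun p q => ?_
    rw [mem_plus hx hy hxy, harcs, Finset.mem_insert, Prod.mk.injEq]
    tauto
  rw [hD']
  have hk : 1 < S.card := by
    by_contra hk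
    have h1 := small (by omega) hOre
    have h2 : 1 < D.verts.card := Finset.one_lt_card.mpr ⟨x, hx, y, hy, hxy⟩
    omega
  subst hcard
  obtain ⟨a, ha, b, hb, hab⟩ := Finset.one_lt_card.mp hk
  have hother : ∀ s ∈ S, ∃ t ∈ S, t ≠ s := by
    intro s _
    by_cases h : a = s
    · exact ⟨b, hb, fun h' => hab (h.trans h'.symm)⟩
    · exact ⟨a, ha, h⟩
  by_cases hxS : x ∈ S
  · by_cases hyS : y ∈ S
    · exact absurd (hK x hxS y hyS hxy) hna
    · obtain ⟨t, ht, hts⟩ := hother x hxS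
      exact plus_in hOre hS hK hy hyS ht hxS hts
  · by_cases hyS : y ∈ S
    · obtain ⟨t, ht, hts⟩ := hother y hyS
      exact plus_out hOre hS hK hx hxS ht hyS hts
    · have hxb : x ≠ b := fun h => hxS (h ▸ hb)
      have hyb : b ≠ y := fun h => hyS (h ▸ hb)
      exact plus_trans hx (hS hb) hy hxb hyb hxy
        (plus_out hOre hS hK hx hxS ha hb hab) (plus_in hOre hS hK hy hyS ha hb hab)
end

section
/- Let D be a k-critical digraph, let v and u be adjacent vertices of D each having out-degree and in-degree equal to k − 1, and let φ be an acyclic (k−1)-coloring of D − v. Then the coloring φ' of D − u defined by φ'(v) = φ(u) and φ'(x) = φ(x) for all x ∈ V(D) \ {u, v} is an acyclic (k−1)-coloring of D − u. -/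
theorem transGen_avoid_of_no_succ {R : ℕ → ℕ → Prop} {v : ℕ} (h : ∀ w, ¬ R v w) {x y : ℕ}
    (hxy : Relation.TransGen R x y) (hy : y ≠ v) :
    Relation.TransGen (fun a b => R a b ∧ a ≠ v ∧ b ≠ v) x y := by
  induction hxy with
  | single hab =>
    exact .single ⟨hab, fun e => h _ (e ▸ hab), hy⟩
  | @tail b c _ hbc ih =>
    have hb : b ≠ v := fun e => h _ (e ▸ hbc)
    exact .tail (ih hb) ⟨hbc, hb, hy⟩

/-- A closed walk either avoids `v` or yields both a successor and a predecessor of `v`. -/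
theorem closed_walk_cases {R : ℕ → ℕ → Prop} {v x : ℕ} (hx : Relation.TransGen R x x)
    (h : ¬ Relation.TransGen (fun a b => R a b ∧ a ≠ v ∧ b ≠ v) x x) :
    (∃ w, R v w) ∧ (∃ w, R w v) := by
  constructor
  · by_contra hc
    have hc : ∀ w, ¬ R v w := fun w hw => hc ⟨w, hw⟩
    refine h (transGen_avoid_of_no_succ hc hx ?_)
    rintro rfl
    obtain ⟨w, hw, -⟩ := Relation.TransGen.head'_iff.mp hx
    exact hc _ hw
  · by_contra hc
    have hc : ∀ w, ¬ Function.swap R v w := fun w hw => hc ⟨w, hw⟩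
    have hne : x ≠ v := by
      rintro rfl
      obtain ⟨w, -, hw⟩ := Relation.TransGen.tail'_iff.mp hx
      exact hc _ hw
    have h2 := transGen_avoid_of_no_succ hc (Relation.transGen_swap.mpr hx) hne
    have h3 := Relation.transGen_swap.mpr h2
    exact h (Relation.TransGen.mono (fun a b hab => ⟨hab.1, hab.2.2, hab.2.1⟩) _ _ h3)

open Digr in
/-- Let `D` be a `k`-critical digraph, let `u` and `v` be adjacent
vertices of `D` each with out-degree and in-degree `k - 1`, and let `φ` be an acyclic
`(k-1)`-coloring of `D - v`. Then recoloring by giving `v` the color of `u` (and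
uncoloring `u`) yields an acyclic `(k-1)`-coloring of `D - u`. -/
theorem critical_shift_coloring (k : ℕ) (D : Digr) (hD : D.Critical k)
    (u v : ℕ) (hu : u ∈ D.verts) (hv : v ∈ D.verts)
    (hadj : (u, v) ∈ D.arcs ∨ (v, u) ∈ D.arcs)
    (houtv : D.outDeg v = k - 1) (hinv : D.inDeg v = k - 1)
    (houtu : D.outDeg u = k - 1) (hinu : D.inDeg u = k - 1)
    (φ : ℕ → Fin (k - 1)) (hφ : (D.delete v).GoodColoring (k - 1) φ) :
    (D.delete u).GoodColoring (k - 1) (fun x => if x = v then φ u else φ x) := by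
  have hnc : ¬ D.Colorable (k - 1) := by
    have hk : k - 1 < k := by
      have := (φ u).isLt
      omega
    exact Nat.notMem_of_lt_sInf (s := {n | D.Colorable n}) (by
      have h := hD.1
      unfold Digr.dichrom at h
      omega)
  have key : ∀ c : Fin (k - 1), (∃ w, (v, w) ∈ D.arcs ∧ φ w = c) ∧
      (∃ w, (w, v) ∈ D.arcs ∧ φ w = c) := by
    intro c
    have h1 : ¬ D.GoodColoring (k - 1) (fun x => if x = v then c else φ x) :=
      fun h => hnc ⟨_, h⟩
    unfold Digr.GoodColoring at h1
    push Not at h1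
    obtain ⟨x, hx⟩ := h1
    obtain ⟨⟨w, hw, hwc⟩, ⟨w', hw', hwc'⟩⟩ := closed_walk_cases (v := v) hx (by
      intro h
      refine hφ x (Relation.TransGen.mono ?_ _ _ h)
      rintro a b ⟨⟨hab, hc⟩, ha, hb⟩
      simp only [ha, hb, if_false] at hc
      exact ⟨Finset.mem_filter.mpr ⟨hab, ha, hb⟩, hc⟩)
    have hn : w ≠ v := (D.no_loops _ hw).symm
    have hn' : w' ≠ v := D.no_loops _ hw'
    simp only [hn, hn', if_true, if_false] at hwc hwc'
    exact ⟨⟨w, hw, hwc.symm⟩, ⟨w', hw', hwc'⟩⟩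
  have injOut : Set.InjOn φ (D.outNbrs v) := by
    refine Finset.injOn_of_surjOn_of_card_le (t := Finset.univ) φ (fun _ _ => by simp) ?_ ?_
    · intro c _
      obtain ⟨w, hw, hc⟩ := (key c).1
      exact ⟨w, Finset.mem_coe.mpr (Finset.mem_filter.mpr ⟨(D.arcs_sub _ hw).2, hw⟩), hc⟩
    · rw [Finset.card_univ, Fintype.card_fin]
      exact houtv.le
  have injIn : Set.InjOn φ (D.inNbrs v) := by
    refine Finset.injOn_of_surjOn_of_card_le (t := Finset.univ) φ (fun _ _ => by simp) ?_ ?_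
    · intro c _
      obtain ⟨w, hw, hc⟩ := (key c).2
      exact ⟨w, Finset.mem_coe.mpr (Finset.mem_filter.mpr ⟨(D.arcs_sub _ hw).1, hw⟩), hc⟩
    · rw [Finset.card_univ, Fintype.card_fin]
      exact hinv.le
  intro x hx
  obtain ⟨⟨w, hw, hwc⟩, ⟨w', hw', hwc'⟩⟩ := closed_walk_cases (v := v) hx (by
    intro h
    refine hφ x (Relation.TransGen.mono ?_ _ _ h)
    rintro a b ⟨⟨hab, hc⟩, ha, hb⟩
    simp only [ha, hb, if_false] at hc
    exact ⟨Finset.mem_filter.mpr ⟨(Finset.mem_filter.mp hab).1, ha, hb⟩, hc⟩)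
  obtain ⟨hw, -, hwu⟩ := Finset.mem_filter.mp hw
  obtain ⟨hw', hwu', -⟩ := Finset.mem_filter.mp hw'
  have hn : w ≠ v := (D.no_loops _ hw).symm
  have hn' : w' ≠ v := D.no_loops _ hw'
  simp only [hn, hn', if_true, if_false] at hwc hwc'
  rcases hadj with ha | ha
  · exact hwu' (injIn (Finset.mem_coe.mpr (Finset.mem_filter.mpr ⟨(D.arcs_sub _ hw').1, hw'⟩))
      (Finset.mem_coe.mpr (Finset.mem_filter.mpr ⟨hu, ha⟩)) hwc')
  · exact hwu (injOut (Finset.mem_coe.mpr (Finset.mem_filter.mpr ⟨(D.arcs_sub _ hw).2, hw⟩))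
      (Finset.mem_coe.mpr (Finset.mem_filter.mpr ⟨hu, ha⟩)) hwc.symm)
end

section
/- Let D be a k-critical digraph and let D_L be its low vertex subdigraph, i.e., the subdigraph of D induced by the vertices v with d⁺_D(v) = d⁻_D(v) = k − 1. Then every block B of D_L satisfies one of the following: (a) B consists of a single arc; (b) B is a directed cycle of length ≥ 2; (c) B is a bidirected cycle of odd length; (d) B is a bidirected complete graph. -/
namespace GB

open Relation

/-- Arc of `D` from `x` to `y` (if `d` is true) or from `y` to `x` (if `d` is false). -/
def arc (D : Digr) (d : Bool) (x y : ℕ) : Prop :=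
  (d = true ∧ (x, y) ∈ D.arcs) ∨ (d = false ∧ (y, x) ∈ D.arcs)

/-- Adjacency in the underlying graph. -/
def Adj (D : Digr) (x y : ℕ) : Prop := ∃ d, arc D d x y

lemma arc_flip {D : Digr} {d : Bool} {x y : ℕ} : arc D (!d) x y ↔ arc D d y x := by
  cases d <;> simp [arc]

lemma arc_true {D : Digr} {x y : ℕ} : arc D true x y ↔ (x, y) ∈ D.arcs := by simp [arc]

lemma arc_false {D : Digr} {x y : ℕ} : arc D false x y ↔ (y, x) ∈ D.arcs := by simp [arc]

lemma arc_ne {D : Digr} {d : Bool} {x y : ℕ} (h : arc D d x y) : x ≠ y := by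
  rcases h with ⟨_, h⟩ | ⟨_, h⟩
  · exact D.no_loops _ h
  · exact (D.no_loops _ h).symm

lemma Adj.symm {D : Digr} {x y : ℕ} (h : Adj D x y) : Adj D y x := by
  obtain ⟨d, h⟩ := h
  exact ⟨!d, arc_flip.2 h⟩

lemma adj_comm {D : Digr} {x y : ℕ} : Adj D x y ↔ Adj D y x := ⟨Adj.symm, Adj.symm⟩

lemma Adj.ne {D : Digr} {x y : ℕ} (h : Adj D x y) : x ≠ y := by
  obtain ⟨d, h⟩ := h
  exact arc_ne h

lemma Adj.or {D : Digr} {x y : ℕ} (h : Adj D x y) (d : Bool) : arc D d x y ∨ arc D (!d) x y := by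
  obtain ⟨e, h⟩ := h
  cases d <;> cases e <;> simp [h]

lemma adj_iff {D : Digr} {x y : ℕ} : Adj D x y ↔ (x, y) ∈ D.arcs ∨ (y, x) ∈ D.arcs := by
  constructor
  · intro h; simpa [arc_true, arc_false] using h.or true
  · rintro (h | h)
    · exact ⟨true, arc_true.2 h⟩
    · exact ⟨false, arc_false.2 h⟩

/-- The context: a set `S` of low vertices, connected and without separating vertex. -/
structure Ctx (D : Digr) (n : ℕ) (S : Finset ℕ) : Prop where
  ncol : ¬ D.Colorable n
  low : ∀ v ∈ S, D.outDeg v = n ∧ D.inDeg v = n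
  ex : ∀ v ∈ S, ∃ φ, (D.delete v).GoodColoring n φ
  conn : ∀ x ∈ S, ∀ y ∈ S, ReflTransGen (fun a b => a ∈ S ∧ b ∈ S ∧ Adj D a b) x y
  sep : ∀ v ∈ S, ∀ x ∈ S, ∀ y ∈ S, x ≠ v → y ≠ v →
    ReflTransGen (fun a b => (a ∈ S ∧ a ≠ v) ∧ (b ∈ S ∧ b ≠ v) ∧ Adj D a b) x y

lemma transGen_avoid {R : ℕ → ℕ → Prop} {v : ℕ} (h : ∀ y, ¬ R v y) {u w : ℕ}
    (hw : w ≠ v) (t : TransGen R u w) : TransGen (fun x y => R x y ∧ x ≠ v ∧ y ≠ v) u w := by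
  induction t using TransGen.head_induction_on with
  | single h1 =>
    refine TransGen.single ⟨h1, ?_, hw⟩
    rintro rfl; exact h _ h1
  | head h1 h2 ih =>
    refine TransGen.head ⟨h1, ?_, ?_⟩ ih
    · rintro rfl; exact h _ h1
    · rintro rfl
      obtain ⟨c, hc, _⟩ := TransGen.head'_iff.1 h2
      exact h _ hc

lemma transGen_avoid' {R : ℕ → ℕ → Prop} {v : ℕ} (h : ∀ y, ¬ R v y) {u : ℕ}
    (t : TransGen R u u) : TransGen (fun x y => R x y ∧ x ≠ v ∧ y ≠ v) u u := by
  apply transGen_avoid h _ t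
  rintro rfl
  obtain ⟨c, hc, _⟩ := TransGen.head'_iff.1 t
  exact h _ hc

lemma good_ext {D D' : Digr} {n v : ℕ} {φ φ' : ℕ → Fin n} (hsub : D'.arcs ⊆ D.arcs)
    (st : (D.delete v).GoodColoring n φ) (hφ : ∀ w, w ≠ v → φ' w = φ w) (d : Bool)
    (h : ∀ y, arc D' d v y → φ' y ≠ φ' v) : D'.GoodColoring n φ' := by
  intro u t
  have key : TransGen (fun x y => ((x, y) ∈ D'.arcs ∧ φ' x = φ' y) ∧ x ≠ v ∧ y ≠ v) u u := by
    cases d with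
    | true =>
      apply transGen_avoid' _ t
      rintro y ⟨h1, h2⟩
      exact h y (arc_true.2 h1) h2.symm
    | false =>
      have t' := transGen_swap.1 t
      have := transGen_avoid' (v := v) (by
        rintro y ⟨h1, h2⟩
        exact h y (arc_false.2 h1) h2) t'
      have t2 := transGen_swap.1 this
      refine TransGen.mono ?_ _ _ t2
      rintro x y ⟨h1, h2, h3⟩
      exact ⟨h1, h3, h2⟩
  refine st u (TransGen.mono ?_ _ _ key)
  rintro x y ⟨⟨h1, h2⟩, h3, h4⟩
  refine ⟨Finset.mem_filter.2 ⟨hsub h1, h3, h4⟩, ?_⟩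
  rw [← hφ x h3, ← hφ y h4, h2]

variable {D : Digr} {n : ℕ} {S : Finset ℕ}

lemma Ctx.surj (C : Ctx D n S) {v : ℕ} {φ : ℕ → Fin n}
    (st : (D.delete v).GoodColoring n φ) (d : Bool) (c : Fin n) :
    ∃ y, arc D d v y ∧ φ y = c := by
  by_contra hcon
  push Not at hcon
  apply C.ncol
  refine ⟨Function.update φ v c, good_ext (Finset.Subset.refl _) st ?_ d ?_⟩
  · intro w hw; simp [hw]
  · intro y hy
    have := arc_ne hy
    simp [this.symm]
    exact hcon y hy

lemma Ctx.inj (C : Ctx D n S) {v : ℕ} (hv : v ∈ S) {φ : ℕ → Fin n}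
    (st : (D.delete v).GoodColoring n φ) {d : Bool} {x y : ℕ} (hx : arc D d v x)
    (hy : arc D d v y) (h : φ x = φ y) : x = y := by
  cases d with
  | true =>
    have := Finset.injOn_of_surjOn_of_card_le (s := D.outNbrs v) (t := Finset.univ) φ
      (fun _ _ => by simp) (by
        intro c _
        obtain ⟨y, hy, hc⟩ := C.surj st true c
        refine ⟨y, ?_, hc⟩
        rw [arc_true] at hy
        simp only [Digr.outNbrs, Finset.coe_filter, Set.mem_ofPred_eq]
        exact ⟨(D.arcs_sub _ hy).2, hy⟩) (by
        simpa [Digr.outDeg] using (C.low v hv).1.le)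
    rw [arc_true] at hx hy
    apply this _ _ h
    · simp only [Digr.outNbrs, Finset.coe_filter, Set.mem_ofPred_eq]
      exact ⟨(D.arcs_sub _ hx).2, hx⟩
    · simp only [Digr.outNbrs, Finset.coe_filter, Set.mem_ofPred_eq]
      exact ⟨(D.arcs_sub _ hy).2, hy⟩
  | false =>
    have := Finset.injOn_of_surjOn_of_card_le (s := D.inNbrs v) (t := Finset.univ) φ
      (fun _ _ => by simp) (by
        intro c _
        obtain ⟨y, hy, hc⟩ := C.surj st false c
        refine ⟨y, ?_, hc⟩
        rw [arc_false] at hy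
        simp only [Digr.inNbrs, Finset.coe_filter, Set.mem_ofPred_eq]
        exact ⟨(D.arcs_sub _ hy).1, hy⟩) (by
        simpa [Digr.inDeg] using (C.low v hv).2.le)
    rw [arc_false] at hx hy
    apply this _ _ h
    · simp only [Digr.inNbrs, Finset.coe_filter, Set.mem_ofPred_eq]
      exact ⟨(D.arcs_sub _ hx).1, hx⟩
    · simp only [Digr.inNbrs, Finset.coe_filter, Set.mem_ofPred_eq]
      exact ⟨(D.arcs_sub _ hy).1, hy⟩

lemma Ctx.move (C : Ctx D n S) {v u : ℕ} (hv : v ∈ S) {φ : ℕ → Fin n}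
    (st : (D.delete v).GoodColoring n φ) (huv : Adj D v u) :
    (D.delete u).GoodColoring n (Function.update φ v (φ u)) := by
  obtain ⟨d, hd⟩ := huv
  refine good_ext (D := D) (Finset.filter_subset _ _) st ?_ d ?_
  · intro w hw; simp [hw]
  · intro y hy heq
    have hy' : arc D d v y ∧ y ≠ u := by
      rcases hy with ⟨h, h1⟩ | ⟨h, h1⟩
      · have := Finset.mem_filter.1 h1
        exact ⟨Or.inl ⟨h, this.1⟩, this.2.2⟩
      · have := Finset.mem_filter.1 h1
        exact ⟨Or.inr ⟨h, this.1⟩, this.2.1⟩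
    have hne := arc_ne hy'.1
    simp [hne.symm] at heq
    exact hy'.2 (C.inj hv st hy'.1 hd heq)

lemma Ctx.moves (C : Ctx D n S) (l : List ℕ) : ∀ (v : ℕ) (φ : ℕ → Fin n),
    (D.delete v).GoodColoring n φ → (∀ x ∈ v :: l, x ∈ S) → (v :: l).Nodup →
    List.IsChain (Adj D) (v :: l) → ∃ φ' : ℕ → Fin n,
      (D.delete ((v :: l).getLast (by simp))).GoodColoring n φ' ∧
      (∀ w, w ∉ v :: l → φ' w = φ w) ∧
      ((v :: l).dropLast).map φ' = l.map φ := by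
  induction l with
  | nil => intro v φ st _ _ _; exact ⟨φ, st, by simp, by simp⟩
  | cons a t ih =>
    intro v φ st hS hnd hch
    rw [List.isChain_cons_cons] at hch
    obtain ⟨φ', h1, h2, h3⟩ := ih a _ (C.move (hS v (by simp)) st hch.1)
      (fun x hx => hS x (List.mem_cons_of_mem _ hx)) (List.nodup_cons.1 hnd).2 hch.2
    have hva := (List.nodup_cons.1 hnd).1
    refine ⟨φ', by simpa using h1, ?_, ?_⟩
    · intro w hw
      rw [h2 w (by simp at hw ⊢; tauto)]
      have : w ≠ v := by rintro rfl; simp at hw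
      simp [this]
    · rw [List.dropLast_cons_of_ne_nil (by simp), List.map_cons, h3, h2 v hva]
      simp only [Function.update_self, List.map_cons, List.cons.injEq, true_and]
      apply List.map_congr_left
      intro b hb
      have : b ≠ v := by rintro rfl; exact hva (List.mem_cons_of_mem _ hb)
      simp [this]

/-- `v :: l` is a closed walk without repeated vertices in `S`. -/
structure Cyc (D : Digr) (S : Finset ℕ) (v : ℕ) (l : List ℕ) : Prop where
  mem : ∀ x ∈ v :: l, x ∈ S
  nodup : (v :: l).Nodup
  chain : List.IsChain (Adj D) (v :: (l ++ [v]))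

lemma Cyc.rot {v a : ℕ} {t : List ℕ} (h : Cyc D S v (a :: t)) : Cyc D S a (t ++ [v]) := by
  obtain ⟨h1, h2, h3⟩ := h
  refine ⟨by intro x hx; apply h1; simp at hx ⊢; tauto, ?_, ?_⟩
  · exact ((List.perm_append_singleton v (a :: t)).nodup_iff).2 h2
  · simp only [List.cons_append, List.isChain_cons_cons] at h3
    rw [List.append_assoc, List.singleton_append, List.isChain_cons_append_cons_cons]
    exact ⟨h3.2, h3.1, by simp⟩

lemma Cyc.rev {v : ℕ} {l : List ℕ} (h : Cyc D S v l) : Cyc D S v l.reverse := by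
  obtain ⟨h1, h2, h3⟩ := h
  refine ⟨by intro x hx; apply h1; simpa using hx, by simpa using h2, ?_⟩
  have : v :: (l.reverse ++ [v]) = (v :: (l ++ [v])).reverse := by simp
  rw [this, List.isChain_reverse]
  exact h3.imp (fun a b h => h.symm)

lemma Cyc.adj_head {v a : ℕ} {l : List ℕ} (h : Cyc D S v l) (ha : l.head? = some a) :
    Adj D v a := by
  cases l with
  | nil => simp at ha
  | cons b t =>
    simp at ha; subst ha
    have := h.chain
    simp only [List.cons_append, List.isChain_cons_cons] at this
    exact this.1

lemma Cyc.adj_last {v a : ℕ} {l : List ℕ} (h : Cyc D S v l) (ha : l.getLast? = some a) :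
    Adj D v a := by
  apply h.rev.adj_head; simpa using ha

/-- One rotation of the colors along a cycle. -/
lemma Ctx.rotate (C : Ctx D n S) {v a : ℕ} {t : List ℕ} (h : Cyc D S v (a :: t))
    {φ : ℕ → Fin n} (st : (D.delete v).GoodColoring n φ) :
    ∃ φ' : ℕ → Fin n, (D.delete v).GoodColoring n φ' ∧
      (∀ w, w ∉ v :: a :: t → φ' w = φ w) ∧ (a :: t).map φ' = t.map φ ++ [φ a] := by
  have hch : List.IsChain (Adj D) (v :: a :: t) := by
    have := h.chain
    rw [← List.cons_append] at this
    exact this.left_of_append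
  obtain ⟨φ', h1, h2, h3⟩ := C.moves (a :: t) v φ st h.mem h.nodup hch
  set x := (v :: a :: t).getLast (by simp) with hx
  have hxl : (a :: t).getLast? = some x := by
    rw [hx, List.getLast_cons (by simp), List.getLast?_eq_getLast_of_ne_nil (by simp)]
  have hxm : x ∈ a :: t := List.mem_of_getLast? hxl
  have hvx : v ≠ x := by
    intro e
    exact (List.nodup_cons.1 h.nodup).1 (e ▸ hxm)
  refine ⟨_, C.move (h.mem x (List.mem_cons_of_mem _ hxm)) h1 (h.adj_last hxl).symm, ?_, ?_⟩
  · intro w hw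
    have : w ≠ x := by rintro rfl; exact hw (List.mem_cons_of_mem _ hxm)
    simp only [ne_eq, this, not_false_eq_true, Function.update_of_ne]
    exact h2 w hw
  · rw [List.dropLast_cons_of_ne_nil (by simp)] at h3
    simp only [List.map_cons, List.cons.injEq] at h3
    obtain ⟨s, hs⟩ : ∃ s, a :: t = s ++ [x] := ⟨(a :: t).dropLast, by
      rw [← List.dropLast_append_getLast? x hxl]; simp⟩
    have hnd := (List.nodup_cons.1 h.nodup).2
    rw [hs] at h3 hnd ⊢
    simp only [List.dropLast_concat] at h3
    rw [List.map_append, List.map_cons, List.map_nil, Function.update_self, h3.1, ← h3.2]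
    congr 1
    apply List.map_congr_left
    intro b hb
    have : b ≠ x := by
      rintro rfl
      exact (List.disjoint_of_nodup_append hnd) hb (by simp)
    simp [this]

/-- Head and last colors after one rotation. -/
lemma Ctx.rotate' (C : Ctx D n S) {v a b x : ℕ} {t : List ℕ} (h : Cyc D S v (a :: b :: t))
    (hx : (a :: b :: t).getLast? = some x)
    {φ : ℕ → Fin n} (st : (D.delete v).GoodColoring n φ) :
    ∃ φ' : ℕ → Fin n, (D.delete v).GoodColoring n φ' ∧
      (∀ w, w ≠ v → w ∉ a :: b :: t → φ' w = φ w) ∧ φ' a = φ b ∧ φ' x = φ a := by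
  obtain ⟨φ', h1, h2, h3⟩ := C.rotate h st
  refine ⟨φ', h1, fun w hw hw' => h2 w (by simp at hw' ⊢; tauto), by simpa using
    (List.cons.inj h3).1, ?_⟩
  have : ((a :: b :: t).map φ').getLast? = some (φ' x) := by
    rw [List.getLast?_map, hx]; rfl
  rw [h3, List.getLast?_concat] at this
  exact (Option.some.inj this).symm

/-- If the last vertex is the only `d`-neighbor of `v` on the cycle, its color is that of
the first one. -/
lemma Ctx.F1 (C : Ctx D n S) {v a b x : ℕ} {t : List ℕ} (h : Cyc D S v (a :: b :: t))
    (hx : (a :: b :: t).getLast? = some x)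
    {φ : ℕ → Fin n} (st : (D.delete v).GoodColoring n φ) {d : Bool} (hd : arc D d v x)
    (hJ : ∀ y ∈ a :: b :: t, arc D d v y → y = x) : φ a = φ x := by
  obtain ⟨φ', h1, h2, h3, h4⟩ := C.rotate' h hx st
  obtain ⟨y, hy, hc⟩ := C.surj st d (φ' x)
  have hv := h.mem v (by simp)
  by_cases hyl : y ∈ a :: b :: t
  · rw [hJ y hyl hy] at hc
    rw [← h4, hc]
  · have : y = x := C.inj hv h1 hy hd (by rw [h2 y (arc_ne hy).symm hyl, hc])
    subst this
    exact absurd (List.mem_of_getLast? hx) hyl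

lemma Ctx.F2 (C : Ctx D n S) {v a b x : ℕ} {t : List ℕ} (h : Cyc D S v (a :: b :: t))
    (hx : (a :: b :: t).getLast? = some x)
    {φ : ℕ → Fin n} (st : (D.delete v).GoodColoring n φ) {d : Bool} (hd : arc D d v x)
    (hda : arc D d v a)
    (hJ : ∀ y ∈ a :: b :: t, arc D d v y → y = a ∨ y = x) : φ b = φ x := by
  obtain ⟨φ', h1, h2, h3, h4⟩ := C.rotate' h hx st
  obtain ⟨y, hy, hc⟩ := C.surj st d (φ' a)
  have hv := h.mem v (by simp)
  have hax : a ≠ x := by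
    rintro rfl
    have : a ∈ b :: t := by
      rw [List.getLast?_cons_cons] at hx
      exact List.mem_of_getLast? hx
    have h5 := (List.nodup_cons.1 (List.nodup_cons.1 h.nodup).2).1
    exact h5 this
  by_cases hyl : y ∈ a :: b :: t
  · rcases hJ y hyl hy with rfl | rfl
    · exfalso
      exact hax (C.inj hv h1 hda hd (by rw [h4, hc]))
    · rw [hc, h3]
  · have : y = a := C.inj hv h1 hy hda (by rw [h2 y (arc_ne hy).symm hyl, hc])
    subst this
    simp at hyl

end GB

namespace GB

open Relation

variable {D : Digr} {n : ℕ} {S : Finset ℕ}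

lemma two_le_decomp {l : List ℕ} (h : 2 ≤ l.length) : ∃ a b t, l = a :: b :: t := by
  match l, h with
  | a :: b :: t, _ => exact ⟨a, b, t, rfl⟩

lemma Ctx.F1g (C : Ctx D n S) {v a x : ℕ} {l : List ℕ} (h : Cyc D S v l) (h2 : 2 ≤ l.length)
    (ha : l.head? = some a) (hx : l.getLast? = some x)
    {φ : ℕ → Fin n} (st : (D.delete v).GoodColoring n φ) {d : Bool} (hd : arc D d v x)
    (hJ : ∀ y ∈ l, arc D d v y → y = x) : φ a = φ x := by
  obtain ⟨a', b, t, rfl⟩ := two_le_decomp h2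
  simp at ha; subst ha
  exact C.F1 h hx st hd hJ

lemma Ctx.F1r (C : Ctx D n S) {v a x : ℕ} {l : List ℕ} (h : Cyc D S v l) (h2 : 2 ≤ l.length)
    (ha : l.head? = some a) (hx : l.getLast? = some x)
    {φ : ℕ → Fin n} (st : (D.delete v).GoodColoring n φ) {d : Bool} (hd : arc D d v a)
    (hJ : ∀ y ∈ l, arc D d v y → y = a) : φ a = φ x :=
  (C.F1g h.rev (by simpa using h2) (by simpa using hx) (by simpa using ha) st hd
    (by simpa using hJ)).symm

lemma Ctx.F2r (C : Ctx D n S) {v a x x' : ℕ} {s : List ℕ} (h : Cyc D S v (s ++ [x', x]))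
    (ha : (s ++ [x', x]).head? = some a)
    {φ : ℕ → Fin n} (st : (D.delete v).GoodColoring n φ) {d : Bool} (hd : arc D d v x)
    (hda : arc D d v a)
    (hJ : ∀ y ∈ s ++ [x', x], arc D d v y → y = a ∨ y = x) : φ x' = φ a := by
  have hr := h.rev
  have e : (s ++ [x', x]).reverse = x :: x' :: s.reverse := by simp
  have e2 : (x :: x' :: s.reverse).getLast? = some a := by
    rw [← e, List.getLast?_reverse]; exact ha
  rw [e] at hr
  refine C.F2 hr e2 st hda hd ?_
  intro y hy hd
  rw [← e, List.mem_reverse] at hy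
  exact (hJ y hy hd).symm

/-- An induced cycle of length at least three. -/
structure ICyc (D : Digr) (S : Finset ℕ) (Z : List ℕ) : Prop where
  cyc : ∀ v l, (v :: l) ~r Z → Cyc D S v l
  len : 3 ≤ Z.length
  ind : ∀ v l, (v :: l) ~r Z → ∀ x ∈ l, Adj D v x → l.head? = some x ∨ l.getLast? = some x

lemma rot_induct {P : List ℕ → Prop} (h : ∀ v l, P (v :: l) → P (l ++ [v])) {Z Z' : List ℕ}
    (hZ : P Z) (hr : Z' ~r Z) : P Z' := by
  obtain ⟨m, hm⟩ := hr.symm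
  subst hm
  induction m generalizing Z with
  | zero => simpa using hZ
  | succ m ih =>
    cases Z with
    | nil => simpa using hZ
    | cons v l =>
      rw [List.rotate_cons_succ]
      exact ih (h v l hZ) (IsRotated.forall' _ _)
  where IsRotated.forall' (l : List ℕ) (m : ℕ) : l.rotate m ~r l := List.IsRotated.forall l m

lemma cyc_all {v : ℕ} {l : List ℕ} (h : Cyc D S v l) (w : ℕ) (k : List ℕ)
    (hr : (w :: k) ~r (v :: l)) : Cyc D S w k := by
  have := rot_induct (P := fun Z => ∀ v l, Z = v :: l → Cyc D S v l) (Z := v :: l)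
    (Z' := w :: k) (by
      intro v l hP v' l' e
      have := hP v l rfl
      cases l with
      | nil => simp at e; obtain ⟨rfl, rfl⟩ := e; exact this
      | cons a t =>
        simp at e; obtain ⟨rfl, rfl⟩ := e; exact this.rot) (by
      intro v' l' e; simp at e; obtain ⟨rfl, rfl⟩ := e; exact h) hr
  exact this w k rfl

lemma ICyc.len' {Z l : List ℕ} {v : ℕ} (h : ICyc D S Z) (hr : (v :: l) ~r Z) :
    2 ≤ l.length := by
  have := hr.perm.length_eq
  have := h.len
  simp at *; omega

lemma ICyc.of_rot {Z Z' : List ℕ} (h : ICyc D S Z) (hr : Z' ~r Z) : ICyc D S Z' :=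
  ⟨fun v l hv => h.cyc v l (hv.trans hr), by rw [hr.perm.length_eq]; exact h.len,
    fun v l hv => h.ind v l (hv.trans hr)⟩

lemma ICyc.J {Z l : List ℕ} {v a x : ℕ} (h : ICyc D S Z) (hr : (v :: l) ~r Z)
    (ha : l.head? = some a) (hx : l.getLast? = some x) {y : ℕ} (hy : y ∈ l)
    (hv : Adj D v y) : y = a ∨ y = x := by
  rcases h.ind v l hr y hy hv with h | h
  · rw [ha] at h; left; exact (Option.some.inj h).symm
  · rw [hx] at h; right; exact (Option.some.inj h).symm

lemma head_ne_last {l : List ℕ} {a x : ℕ} (hnd : l.Nodup) (h2 : 2 ≤ l.length)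
    (ha : l.head? = some a) (hx : l.getLast? = some x) : a ≠ x := by
  obtain ⟨a', b, t, rfl⟩ := two_le_decomp h2
  simp at ha; subst ha
  rintro rfl
  rw [List.getLast?_cons_cons] at hx
  exact (List.nodup_cons.1 hnd).1 (List.mem_of_getLast? hx)

/-- The vertex `v` is passed through in direction `d`. -/
def TA (D : Digr) (d : Bool) (v a x : ℕ) : Prop :=
  arc D d v a ∧ ¬ arc D d v x ∧ arc D (!d) v x ∧ ¬ arc D (!d) v a

lemma Ctx.TAcol (C : Ctx D n S) {Z l : List ℕ} {v a x : ℕ} (h : ICyc D S Z)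
    (hr : (v :: l) ~r Z) (ha : l.head? = some a) (hx : l.getLast? = some x) {d : Bool}
    (h1 : arc D d v a) (h2 : ¬ arc D d v x)
    {φ : ℕ → Fin n} (st : (D.delete v).GoodColoring n φ) : φ a = φ x := by
  refine C.F1r (h.cyc v l hr) (h.len' hr) ha hx st h1 ?_
  intro y hy hd
  rcases h.J hr ha hx hy ⟨d, hd⟩ with rfl | rfl
  · rfl
  · exact absurd hd h2

lemma Ctx.TAcol' (C : Ctx D n S) {Z l : List ℕ} {v a x : ℕ} (h : ICyc D S Z)
    (hr : (v :: l) ~r Z) (ha : l.head? = some a) (hx : l.getLast? = some x) {d : Bool}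
    (h1 : arc D d v x) (h2 : ¬ arc D d v a)
    {φ : ℕ → Fin n} (st : (D.delete v).GoodColoring n φ) : φ a = φ x := by
  refine C.F1g (h.cyc v l hr) (h.len' hr) ha hx st h1 ?_
  intro y hy hd
  rcases h.J hr ha hx hy ⟨d, hd⟩ with rfl | rfl
  · exact absurd hd h2
  · rfl

lemma Ctx.dich (C : Ctx D n S) {Z l : List ℕ} {v a x : ℕ} (h : ICyc D S Z)
    (hr : (v :: l) ~r Z) (ha : l.head? = some a) (hx : l.getLast? = some x) :
    (∃ d, TA D d v a x) ∨ ∀ d, arc D d v a ↔ arc D d v x := by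
  have hc := h.cyc v l hr
  have hv := hc.mem v (by simp)
  have hax := head_ne_last (List.nodup_cons.1 hc.nodup).2 (h.len' hr) ha hx
  obtain ⟨φ, st⟩ := C.ex v hv
  have key : φ a = φ x → ∀ e, arc D e v a → ¬ arc D e v x := by
    intro he e h1 h2
    exact hax (C.inj hv st h1 h2 he)
  by_contra hcon
  push Not at hcon
  obtain ⟨hcon, d, hd⟩ := hcon
  rcases hd with ⟨h1, h2⟩ | ⟨h1, h2⟩
  · have he := C.TAcol h hr ha hx h1 h2 st
    have h3 : arc D (!d) v x := ((hc.adj_last hx).or d).resolve_left h2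
    exact hcon d ⟨h1, h2, h3, fun h4 => key he _ h4 h3⟩
  · have he := C.TAcol' h hr ha hx h2 h1 st
    have h3 : arc D (!d) v a := ((hc.adj_head ha).or d).resolve_left h1
    exact hcon (!d) ⟨h3, key he _ h3, by simpa using h2, by simpa using h1⟩

lemma Ctx.TA_second (C : Ctx D n S) {Z t : List ℕ} {v a b x : ℕ} (h : ICyc D S Z)
    (hr : (v :: a :: b :: t) ~r Z) (hx : (a :: b :: t).getLast? = some x) {d : Bool}
    (hT : TA D d v a x) {φ : ℕ → Fin n} (st : (D.delete v).GoodColoring n φ) : φ b = φ a := by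
  obtain ⟨φ', h1, h2, h3, h4⟩ := C.rotate' (h.cyc _ _ hr) hx st
  rw [← h3, ← h4]
  exact C.TAcol h hr rfl hx hT.1 hT.2.1 h1

lemma Ctx.TA_second' (C : Ctx D n S) {Z s : List ℕ} {v a x' x : ℕ} (h : ICyc D S Z)
    (hr : (v :: (s ++ [x', x])) ~r Z) (ha : (s ++ [x', x]).head? = some a) {d : Bool}
    (hT : TA D d v a x) {φ : ℕ → Fin n} (st : (D.delete v).GoodColoring n φ) : φ x' = φ x := by
  have hc := (h.cyc _ _ hr).rev
  have e : (s ++ [x', x]).reverse = x :: x' :: s.reverse := by simp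
  have e2 : (x :: x' :: s.reverse).getLast? = some a := by
    rw [← e, List.getLast?_reverse]; exact ha
  rw [e] at hc
  obtain ⟨φ', h1, h2, h3, h4⟩ := C.rotate' hc e2 st
  rw [← h3, ← h4]
  exact (C.TAcol h hr ha (by simp) hT.1 hT.2.1 h1).symm

lemma rot_next {Z t : List ℕ} {v a : ℕ} (hr : (v :: a :: t) ~r Z) :
    (a :: (t ++ [v])) ~r Z :=
  (List.isRotated_concat v (a :: t)).trans hr

lemma Ctx.TA_next (C : Ctx D n S) {Z t : List ℕ} {v a b x : ℕ} (h : ICyc D S Z)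
    (hr : (v :: a :: b :: t) ~r Z) (hx : (a :: b :: t).getLast? = some x) {d : Bool}
    (hT : TA D d v a x) : TA D d a b v := by
  have hc := h.cyc _ _ hr
  have hv := hc.mem v (by simp)
  have ha := hc.mem a (by simp)
  obtain ⟨φ, st⟩ := C.ex v hv
  have h1 := C.TA_second h hr hx hT st
  have st' := C.move hv st ⟨d, hT.1⟩
  have hvb : b ≠ v := by
    have := hc.nodup
    simp at this; tauto
  have he : (Function.update φ v (φ a)) b = (Function.update φ v (φ a)) v := by
    simp [hvb, h1]
  have key : ∀ e, arc D e a b → arc D e a v → False := fun e h1 h2 =>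
    hvb (C.inj ha st' h1 h2 he)
  have hc2 := h.cyc _ _ (rot_next hr)
  have hab : Adj D a b := hc2.adj_head (by simp)
  have h3 : arc D (!d) a v := arc_flip.2 hT.1
  have h4 : ¬ arc D (!d) a b := fun h => key _ h h3
  have h5 : arc D d a b := (hab.or d).resolve_right h4
  exact ⟨h5, fun h => key _ h5 h, h3, h4⟩

/-- `Z` is directed. -/
def Dir (D : Digr) (d : Bool) (Z : List ℕ) : Prop :=
  ∀ v l a x, (v :: l) ~r Z → l.head? = some a → l.getLast? = some x → TA D d v a x

/-- `Z` is bidirected. -/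
def Bid (D : Digr) (Z : List ℕ) : Prop :=
  ∀ v l a x, (v :: l) ~r Z → l.head? = some a → l.getLast? = some x →
    ∀ e, arc D e v a ∧ arc D e v x

lemma Ctx.parity (C : Ctx D n S) {Z l : List ℕ} {v a x : ℕ} (h : ICyc D S Z)
    (hr : (v :: l) ~r Z) (ha : l.head? = some a) (hx : l.getLast? = some x) {d : Bool}
    (h1 : arc D d v a) (h2 : arc D d v x) : Even l.length := by
  have hc := h.cyc v l hr
  have hv := hc.mem v (by simp)
  have hl := h.len' hr
  have hax := head_ne_last (List.nodup_cons.1 hc.nodup).2 hl ha hx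
  obtain ⟨φ, st⟩ := C.ex v hv
  have hrot : ∀ m, ∃ φ' : ℕ → Fin n, (D.delete v).GoodColoring n φ' ∧
      l.map φ' = (l.map φ).rotate m := by
    intro m
    induction m with
    | zero => exact ⟨φ, st, by simp⟩
    | succ m ih =>
      obtain ⟨φ', s1, s2⟩ := ih
      obtain ⟨a', b, t, rfl⟩ := two_le_decomp hl
      obtain ⟨φ'', r1, r2, r3⟩ := C.rotate hc s1
      refine ⟨φ'', r1, ?_⟩
      rw [← List.rotate_rotate, ← s2, r3]
      simp
  set M := l.length with hM
  have hcl : ∀ i, (l.map φ)[i % M]? = (l.map φ)[i % M]'(by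
      simp; exact Nat.mod_lt _ (by omega)) := by
    intro i
    rw [List.getElem?_eq_getElem]
  set c : ℕ → Fin n := fun i => (l.map φ)[i % M]'(by
      simp; exact Nat.mod_lt _ (by omega)) with hcdef
  have step : ∀ m, c (m + 1) = c (m + (M - 1)) ∧ c m ≠ c (m + (M - 1)) := by
    intro m
    obtain ⟨φ', s1, s2⟩ := hrot m
    have hg : ∀ j (hj : j < M), φ' (l[j]) = c (m + j) := by
      intro j hj
      have e1 : (l.map φ')[j]'(by simpa using hj) = φ' l[j] := by simp
      rw [← e1]
      simp only [s2, hcdef]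
      rw [List.getElem_rotate]
      simp [hM, add_comm]
    have ea : a = l[0] := by
      obtain ⟨a', b, t, rfl⟩ := two_le_decomp hl
      simpa using ha.symm
    have ex : x = l[M - 1] := by
      rw [List.getLast?_eq_getElem?, List.getElem?_eq_getElem (by omega)] at hx
      exact (Option.some.inj hx).symm
    constructor
    · have := hg 1 (by omega)
      rw [← this, ← hg (M - 1) (by omega), ← ex]
      have hb : ∃ b t, l = a :: b :: t := by
        obtain ⟨a', b, t, rfl⟩ := two_le_decomp hl
        simp at ha; subst ha; exact ⟨b, t, rfl⟩
      obtain ⟨b, t, e⟩ := hb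
      have : l[1] = b := by simp [e]
      rw [this]
      have hJ : ∀ y ∈ l, arc D d v y → y = a ∨ y = x :=
        fun y hy hd => h.J hr ha hx hy ⟨d, hd⟩
      rw [e] at hc hx hJ
      exact C.F2 hc hx s1 h2 h1 hJ
    · have e0 := hg 0 (by omega)
      have e1 := hg (M - 1) (by omega)
      rw [← ex] at e1; rw [← ea] at e0
      rw [← e1]
      simp only [add_zero] at e0
      rw [← e0]
      exact fun he => hax (C.inj hv s1 h1 h2 he)
  have cper : ∀ i, c (i + M) = c i := by intro i; simp [hcdef]
  have c2 : ∀ i, c (i + 2) = c i := by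
    intro i
    rw [(step (i + 1)).1, show i + 1 + (M - 1) = i + M by omega, cper]
  have c1 : c 0 ≠ c 1 := by
    intro e
    have h0 := (step 0).1
    have h3 := (step 0).2
    simp only [zero_add] at h0 h3
    rw [← h0] at h3
    exact h3 e
  by_contra hodd
  rw [Nat.not_even_iff_odd] at hodd
  obtain ⟨j, hj⟩ := hodd
  have : ∀ i, c (2 * i + 1) = c 1 := by
    intro i
    induction i with
    | zero => rfl
    | succ i ih => rw [show 2 * (i + 1) + 1 = 2 * i + 1 + 2 by ring, c2, ih]
  apply c1
  rw [← this j, ← hj]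
  simpa using (cper 0).symm

lemma Ctx.classify (C : Ctx D n S) {Z : List ℕ} (h : ICyc D S Z) :
    (∃ d, Dir D d Z) ∨ Bid D Z := by
  by_cases hT : ∃ v l a x d, (v :: l) ~r Z ∧ l.head? = some a ∧ l.getLast? = some x ∧
      TA D d v a x
  · left
    obtain ⟨v, l, a, x, d, hr, ha, hx, hT⟩ := hT
    refine ⟨d, ?_⟩
    have := fun w k (hw : (w :: k) ~r (v :: l)) => rot_induct
      (P := fun Y => Y ~r Z ∧ ∀ v l a x, Y = v :: l → l.head? = some a → l.getLast? = some x →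
        TA D d v a x) (Z := v :: l) (Z' := w :: k) (by
        rintro v l ⟨hr, hP⟩
        refine ⟨(List.isRotated_concat _ _).trans hr, ?_⟩
        intro v' l' a' x' e ha' hx'
        obtain ⟨a, b, t, rfl⟩ := two_le_decomp (h.len' hr)
        simp at e; obtain ⟨rfl, rfl⟩ := e
        simp at ha'; subst ha'
        rw [← List.cons_append, List.getLast?_concat] at hx'; cases hx'
        have hz : (a :: b :: t).getLast? = some ((a :: b :: t).getLast (by simp)) :=
          List.getLast?_eq_getLast_of_ne_nil _
        exact C.TA_next h hr hz (hP v _ a _ rfl rfl hz)) ⟨hr, by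
          intro v' l' a' x' e ha' hx'
          simp at e; obtain ⟨rfl, rfl⟩ := e
          rw [ha] at ha'; rw [hx] at hx'
          cases ha'; cases hx'
          exact hT⟩ hw
    intro w k a' x' hw ha' hx'
    exact (this w k (hw.trans hr.symm)).2 w k a' x' rfl ha' hx'
  · right
    push Not at hT
    have hTB : ∀ v l a x, (v :: l) ~r Z → l.head? = some a → l.getLast? = some x →
        ∀ d, arc D d v a ↔ arc D d v x := by
      intro v l a x hr ha hx
      rcases C.dich h hr ha hx with ⟨d, hd⟩ | h1
      · exact absurd hd (hT v l a x d hr ha hx)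
      · exact h1
    intro v l a x hr ha hx
    suffices hs : ∀ e, arc D e v a from fun e => ⟨hs e, (hTB v l a x hr ha hx e).1 (hs e)⟩
    by_contra hcon
    push Not at hcon
    obtain ⟨e, he⟩ := hcon
    have hc := h.cyc v l hr
    have he' : arc D (!e) v a := ((hc.adj_head ha).or e).resolve_left he
    have hpar := C.parity h hr ha hx he' ((hTB v l a x hr ha hx _).1 he')
    -- sources and sinks alternate
    have key : ∀ m, ∃ w k b, (v :: l).rotate m = w :: k ∧ k.head? = some b ∧
        (arc D ((decide (Even m)) ^^ e) w b) ∧ ¬ arc D (!((decide (Even m)) ^^ e)) w b := by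
      intro m
      induction m with
      | zero => exact ⟨v, l, a, by simp, ha, by simpa using he', by simpa using he⟩
      | succ m ih =>
        obtain ⟨w, k, b, e1, e2, e3, e4⟩ := ih
        have hr' : (w :: k) ~r Z := by
          rw [← e1]; exact (List.IsRotated.forall _ _).trans hr
        obtain ⟨b', c, t, rfl⟩ := two_le_decomp (h.len' hr')
        simp at e2; subst e2
        have hn := hTB b' (c :: (t ++ [w])) c w (rot_next hr') rfl (by
          rw [← List.cons_append, List.getLast?_concat])
        refine ⟨b', c :: (t ++ [w]), c, ?_, rfl, ?_, ?_⟩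
        · rw [← List.rotate_rotate, e1]; simp
        · rw [hn]
          have : (decide (Even (m + 1)) ^^ e) = !(decide (Even m) ^^ e) := by
            simp only [Nat.even_add_one]; by_cases hm : Even m <;> simp [hm]
          rw [this, arc_flip]; exact e3
        · rw [hn]
          have : (decide (Even (m + 1)) ^^ e) = !(decide (Even m) ^^ e) := by
            simp only [Nat.even_add_one]; by_cases hm : Even m <;> simp [hm]
          rw [this, arc_flip]; exact e4
    obtain ⟨w, k, b, e1, e2, e3, e4⟩ := key (v :: l).length
    rw [List.rotate_length] at e1
    obtain ⟨rfl, rfl⟩ := List.cons.inj e1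
    rw [ha] at e2; cases e2
    have : ¬ Even (v :: l).length := by simp [Nat.even_add_one, hpar]
    simp only [this] at e3
    simp at e3
    exact he e3

end GB

namespace GB

open Relation

variable {D : Digr} {n : ℕ} {S : Finset ℕ}

lemma two_le_decomp_last {l : List ℕ} (h : 2 ≤ l.length) : ∃ s x' x, l = s ++ [x', x] := by
  obtain ⟨a, b, t, e⟩ := two_le_decomp (l := l.reverse) (by simpa using h)
  refine ⟨t.reverse, b, a, ?_⟩
  rw [← List.reverse_reverse l, e]; simp

lemma mem_rot {Z : List ℕ} {z : ℕ} (h : z ∈ Z) : ∃ l, (z :: l) ~r Z := by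
  obtain ⟨A, B, rfl⟩ := List.append_of_mem h
  exact ⟨B ++ A, by simpa using (List.isRotated_append (l := z :: B) (l' := A))⟩

lemma dup_decomp {q : List ℕ} (h : ¬ q.Nodup) : ∃ A y B E, q = A ++ y :: (B ++ y :: E) := by
  induction q with
  | nil => simp at h
  | cons a t ih =>
    by_cases ha : a ∈ t
    · obtain ⟨B, E, rfl⟩ := List.append_of_mem ha
      exact ⟨[], a, B, E, rfl⟩
    · have : ¬ t.Nodup := fun h' => h (List.nodup_cons.2 ⟨ha, h'⟩)
      obtain ⟨A, y, B, E, rfl⟩ := ih this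
      exact ⟨a :: A, y, B, E, rfl⟩

/-- An ear of the cycle `Z`. -/
structure Ear (D : Digr) (S : Finset ℕ) (Z : List ℕ) (z : ℕ) (q : List ℕ) (z' : ℕ) : Prop where
  hz : z ∈ Z
  hz' : z' ∈ Z
  ne : z ≠ z'
  qne : q ≠ []
  mem : ∀ y ∈ q, y ∈ S ∧ y ∉ Z
  chain : List.IsChain (Adj D) (z :: (q ++ [z']))

/-- A shortest ear. -/
structure MinEar (D : Digr) (S : Finset ℕ) (Z : List ℕ) (z : ℕ) (q : List ℕ) (z' : ℕ) : Prop
    extends Ear D S Z z q z' where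
  min : ∀ w p w', Ear D S Z w p w' → q.length ≤ p.length

lemma Ear.rev {Z q : List ℕ} {z z' : ℕ} (E : Ear D S Z z q z') : Ear D S Z z' q.reverse z := by
  refine ⟨E.hz', E.hz, E.ne.symm, by simpa using E.qne, by simpa using E.mem, ?_⟩
  have e : z' :: (q.reverse ++ [z]) = (z :: (q ++ [z'])).reverse := by simp
  rw [e, List.isChain_reverse]
  exact E.chain.imp fun _ _ h => h.symm

lemma MinEar.rev {Z q : List ℕ} {z z' : ℕ} (E : MinEar D S Z z q z') :
    MinEar D S Z z' q.reverse z :=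
  ⟨E.toEar.rev, by simpa using E.min⟩

lemma MinEar.nodup {Z q : List ℕ} {z z' : ℕ} (E : MinEar D S Z z q z') : q.Nodup := by
  by_contra hcon
  obtain ⟨A, y, B, F, rfl⟩ := dup_decomp hcon
  have hc := E.chain
  simp only [List.append_assoc, List.cons_append] at hc
  rw [List.isChain_cons_split] at hc
  obtain ⟨c1, c2⟩ := hc
  rw [List.isChain_cons_split] at c2
  have : Ear D S Z z (A ++ y :: F) z' := by
    refine ⟨E.hz, E.hz', E.ne, by simp, ?_, ?_⟩
    · intro w hw; apply E.mem; simp at hw ⊢; tauto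
    · simp only [List.append_assoc, List.cons_append]
      rw [List.isChain_cons_split]
      exact ⟨c1, c2.2⟩
  have := E.min _ _ _ this
  simp at this
  omega

lemma MinEar.tail {Z q : List ℕ} {z z' y₀ : ℕ} (E : MinEar D S Z z q z')
    (h0 : q.head? = some y₀) {y : ℕ} (hy : y ∈ q) (ha : Adj D z y) : y = y₀ := by
  obtain ⟨A, F, rfl⟩ := List.append_of_mem hy
  rcases A with _ | ⟨a, A⟩
  · simpa using h0
  · exfalso
    have hc := E.chain
    rw [List.append_assoc, List.cons_append (bs := [z']), List.isChain_cons_split] at hc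
    have : Ear D S Z z (y :: F) z' := by
      refine ⟨E.hz, E.hz', E.ne, by simp, ?_, ?_⟩
      · intro w hw; apply E.mem; simp at hw ⊢; tauto
      · rw [List.cons_append, List.isChain_cons_cons]; exact ⟨ha, hc.2⟩
    have := E.min _ _ _ this
    simp at this; omega

lemma Ctx.exists_adj (C : Ctx D n S) {Z : List ℕ} {s z : ℕ} (hs : s ∈ S) (hz : z ∈ S)
    (hsZ : s ∉ Z) (hzZ : z ∈ Z) : ∃ y ∈ S, y ∉ Z ∧ ∃ z ∈ Z, Adj D z y := by
  have := C.conn s hs z hz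
  induction this using ReflTransGen.head_induction_on with
  | refl => exact absurd hzZ hsZ
  | head h1 _ ih =>
    rename_i a c _
    by_cases hc : c ∈ Z
    · exact ⟨a, h1.1, hsZ, c, hc, h1.2.2.symm⟩
    · exact ih h1.2.1 hc

lemma Ctx.exists_ear (C : Ctx D n S) {Z : List ℕ} (h : ICyc D S Z) {s : ℕ} (hs : s ∈ S)
    (hsZ : s ∉ Z) : ∃ z q z', Ear D S Z z q z' := by
  have hsub : ∀ z ∈ Z, z ∈ S := by
    intro z hz
    obtain ⟨l, hl⟩ := mem_rot hz
    exact (h.cyc z l hl).mem z (by simp)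
  have hne : ∃ z, z ∈ Z := by
    have := h.len
    match Z, this with
    | a :: t, _ => exact ⟨a, by simp⟩
  obtain ⟨z0, hz0⟩ := hne
  obtain ⟨y, hy, hyZ, z, hz, hzy⟩ := C.exists_adj hs (hsub _ hz0) hsZ hz0
  obtain ⟨l, hl⟩ := mem_rot hz
  obtain ⟨a, b, t, rfl⟩ := two_le_decomp (h.len' hl)
  have haZ : a ∈ Z := by rw [← hl.mem_iff]; simp
  have haz : a ≠ z := by
    have := (h.cyc _ _ hl).nodup
    simp at this; tauto
  have hyz : y ≠ z := by rintro rfl; exact hyZ hz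
  have key : ∃ q z', z' ∈ Z ∧ z' ≠ z ∧ (∀ w ∈ q, w ∈ S ∧ w ∉ Z) ∧
      List.IsChain (Adj D) (y :: (q ++ [z'])) := by
    have := C.sep z (hsub z hz) y hy a (hsub a haZ) hyz haz
    clear hzy hyz
    induction this using ReflTransGen.head_induction_on with
    | refl => exact absurd haZ hyZ
    | head h1 _ ih =>
      rename_i x c _
      by_cases hc : c ∈ Z
      · exact ⟨[], c, hc, h1.2.1.2, by simp, by simpa using h1.2.2⟩
      · obtain ⟨q, z', e1, e2, e3, e4⟩ := ih h1.2.1.1 hc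
        refine ⟨c :: q, z', e1, e2, ?_, ?_⟩
        · intro w hw
          rcases List.mem_cons.1 hw with rfl | hw
          · exact ⟨h1.2.1.1, hc⟩
          · exact e3 w hw
        · rw [List.cons_append, List.isChain_cons_cons]; exact ⟨h1.2.2, e4⟩
  obtain ⟨q, z', e1, e2, e3, e4⟩ := key
  refine ⟨z, y :: q, z', hz, e1, e2.symm, by simp, ?_, ?_⟩
  · intro w hw
    rcases List.mem_cons.1 hw with rfl | hw
    · exact ⟨hy, hyZ⟩
    · exact e3 w hw
  · rw [List.cons_append, List.isChain_cons_cons]; exact ⟨hzy, e4⟩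

lemma exists_minEar {Z : List ℕ} (h : ∃ z q z', Ear D S Z z q z') :
    ∃ z q z', MinEar D S Z z q z' := by
  classical
  have hP : ∃ m, ∃ z q z', Ear D S Z z q z' ∧ q.length = m := by
    obtain ⟨z, q, z', E⟩ := h; exact ⟨_, z, q, z', E, rfl⟩
  obtain ⟨z, q, z', E, e⟩ := Nat.find_spec hP
  refine ⟨z, q, z', E, fun w p w' E' => ?_⟩
  rw [e]
  exact Nat.find_min' hP ⟨w, p, w', E', rfl⟩

lemma Ear.cyc {Z q A B : List ℕ} {z z' : ℕ} (E : Ear D S Z z q z') (h : ICyc D S Z)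
    (hq : q.Nodup) (hr : (z :: (A ++ z' :: B)) ~r Z) : Cyc D S z (q ++ z' :: B) := by
  have hc := h.cyc _ _ hr
  have hZ : ∀ y, y ∈ Z ↔ y ∈ z :: (A ++ z' :: B) := fun y => hr.mem_iff.symm
  refine ⟨?_, ?_, ?_⟩
  · intro x hx
    simp at hx
    rcases hx with rfl | hx | rfl | hx
    · exact hc.mem _ (by simp)
    · exact (E.mem x hx).1
    · exact hc.mem _ (by simp)
    · exact hc.mem _ (by simp [hx])
  · have hnd := hc.nodup
    rw [List.nodup_cons, List.nodup_append] at hnd ⊢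
    obtain ⟨n1, n2, n3, n4⟩ := hnd
    refine ⟨?_, hq, n3, ?_⟩
    · intro hz
      rcases List.mem_append.1 hz with hz | hz
      · exact (E.mem z hz).2 E.hz
      · exact n1 (List.mem_append_right _ hz)
    · rintro a ha b hb rfl
      apply (E.mem a ha).2
      rw [hZ]
      exact List.mem_cons_of_mem _ (List.mem_append_right _ hb)
  · have hch := hc.chain
    rw [List.append_assoc, List.cons_append, ← List.cons_append, List.isChain_split] at hch ⊢
    exact ⟨E.chain, hch.2⟩

lemma Ear.adj_head {Z q : List ℕ} {z z' y₀ : ℕ} (E : Ear D S Z z q z')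
    (h0 : q.head? = some y₀) : Adj D z y₀ := by
  rcases q with _ | ⟨y, q⟩
  · simp at h0
  · simp at h0; subst h0
    have := E.chain
    rw [List.cons_append, List.isChain_cons_cons] at this
    exact this.1

lemma head_append_ne {q r : List ℕ} {y : ℕ} (h : q.head? = some y) : (q ++ r).head? = some y := by
  simp [List.head?_append, h]

lemma Ctx.ear_dir' (C : Ctx D n S) {Z q A B : List ℕ} {z z' : ℕ} {d : Bool} (h : ICyc D S Z)
    (hD : Dir D d Z) (E : MinEar D S Z z q z') (hr : (z :: (A ++ z' :: B)) ~r Z) (hB : B ≠ []) :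
    False := by
  have hcy := E.toEar.cyc h E.nodup hr
  obtain ⟨s, x', x, e⟩ := two_le_decomp_last (l := z' :: B) (by
    rcases B with _ | _
    · exact absurd rfl hB
    · simp)
  obtain ⟨y₀, h0⟩ : ∃ y₀, q.head? = some y₀ := by
    rcases hq : q with _ | ⟨y, t⟩
    · exact absurd hq E.qne
    · exact ⟨y, rfl⟩
  have h0q : y₀ ∈ q := List.mem_of_head? h0
  have hadj := E.adj_head h0
  have hz : z ∈ S := hcy.mem z (by simp)
  obtain ⟨φ, st⟩ := C.ex z hz
  have hr' : (z :: ((A ++ s) ++ [x', x])) ~r Z := by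
    rw [List.append_assoc, ← e]; exact hr
  have hmem : ∀ y ∈ s ++ [x', x], y ∈ Z := by
    intro y hy; rw [← hr'.mem_iff]; simp at hy ⊢; tauto
  obtain ⟨a, ha⟩ : ∃ a, ((A ++ s) ++ [x', x]).head? = some a := by
    cases hl : ((A ++ s) ++ [x', x]) with
    | nil => simp at hl
    | cons a t => exact ⟨a, rfl⟩
  have hx : ((A ++ s) ++ [x', x]).getLast? = some x := by simp
  have hT := hD _ _ _ _ hr' ha hx
  have c1 := C.TAcol h hr' ha hx hT.1 hT.2.1 st
  have c2 := C.TA_second' h hr' ha hT st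
  have hJ : ∀ y ∈ q ++ (s ++ [x', x]), arc D (!d) z y → y = y₀ ∨ y = x := by
    intro y hy hd
    rcases List.mem_append.1 hy with hy | hy
    · left; exact E.tail h0 hy ⟨_, hd⟩
    · right
      rcases h.J hr' ha hx (by simp at hy ⊢; tauto) ⟨_, hd⟩ with rfl | rfl
      · exact absurd hd hT.2.2.2
      · rfl
  have haZ : a ∈ Z := by
    rw [← hr'.mem_iff]; exact List.mem_cons_of_mem _ (List.mem_of_head? ha)
  have hxZ : x ∈ Z := hmem x (by simp)
  rw [e] at hcy
  by_cases hd : arc D (!d) z y₀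
  · rw [← List.append_assoc] at hcy hJ
    have := C.F2r hcy (head_append_ne (head_append_ne h0)) st hT.2.2.1 hd hJ
    have := C.inj hz st hd hT.2.2.1 (by rw [← this, c2])
    exact (E.mem _ h0q).2 (this ▸ hxZ)
  · have := C.F1g hcy (by simp; omega) (head_append_ne h0) (by simp) st hT.2.2.1 (by
      intro y hy hyd
      rcases hJ y hy hyd with rfl | rfl
      · exact absurd hyd hd
      · rfl)
    have hd' : arc D d z y₀ := (hadj.or d).resolve_right hd
    have := C.inj hz st hd' hT.1 (by rw [this, c1])
    exact (E.mem _ h0q).2 (this ▸ haZ)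

lemma ear_split {Z q : List ℕ} {z z' : ℕ} (E : Ear D S Z z q z') :
    ∃ A B, (z :: (A ++ z' :: B)) ~r Z := by
  obtain ⟨l, hl⟩ := mem_rot E.hz
  have : z' ∈ z :: l := by rw [hl.mem_iff]; exact E.hz'
  rcases List.mem_cons.1 this with h | h
  · exact absurd h.symm E.ne
  · obtain ⟨A, B, rfl⟩ := List.append_of_mem h
    exact ⟨A, B, hl⟩

lemma rot_swap {Z A B : List ℕ} {z z' : ℕ} (hr : (z :: (A ++ z' :: B)) ~r Z) :
    (z' :: (B ++ z :: A)) ~r Z := by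
  refine List.IsRotated.trans ?_ hr
  have := List.isRotated_append (l := z' :: B) (l' := z :: A)
  simpa using this

lemma Ctx.ear_dir (C : Ctx D n S) {Z q : List ℕ} {z z' : ℕ} {d : Bool} (h : ICyc D S Z)
    (hD : Dir D d Z) (E : MinEar D S Z z q z') : False := by
  obtain ⟨A, B, hr⟩ := ear_split E.toEar
  by_cases hB : B = []
  · subst hB
    refine C.ear_dir' h hD E.rev (rot_swap hr) ?_
    rintro rfl
    have := h.len' hr
    simp at this
  · exact C.ear_dir' h hD E hr hB

/-- The bidirected case with nonadjacent ends. -/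
lemma Ctx.ear_bid1 (C : Ctx D n S) {Z q : List ℕ} {z z' : ℕ} (h : ICyc D S Z)
    (hD : Bid D Z) (E : MinEar D S Z z q z') (hna : ¬ Adj D z z') : False := by
  obtain ⟨A, B, hr⟩ := ear_split E.toEar
  have hB : B ≠ [] := by
    rintro rfl
    exact hna ((h.cyc _ _ hr).adj_last (by simp))
  have hA : A ≠ [] := by
    rintro rfl
    exact hna ((h.cyc _ _ hr).adj_head (by simp))
  have hcy := E.toEar.cyc h E.nodup hr
  obtain ⟨s, x', x, e⟩ := two_le_decomp_last (l := z' :: B) (by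
    rcases B with _ | _
    · exact absurd rfl hB
    · simp)
  obtain ⟨y₀, h0⟩ : ∃ y₀, q.head? = some y₀ := by
    rcases hq : q with _ | ⟨y, t⟩
    · exact absurd hq E.qne
    · exact ⟨y, rfl⟩
  have h0q : y₀ ∈ q := List.mem_of_head? h0
  obtain ⟨d, hadj⟩ := E.adj_head h0
  have hz : z ∈ S := hcy.mem z (by simp)
  obtain ⟨φ, st⟩ := C.ex z hz
  have hr' : (z :: ((A ++ s) ++ [x', x])) ~r Z := by
    rw [List.append_assoc, ← e]; exact hr
  obtain ⟨a, hAa⟩ : ∃ a, A.head? = some a := by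
    rcases hq : A with _ | ⟨y, t⟩
    · exact absurd hq hA
    · exact ⟨y, rfl⟩
  have ha : ((A ++ s) ++ [x', x]).head? = some a := head_append_ne (head_append_ne hAa)
  have hx : ((A ++ s) ++ [x', x]).getLast? = some x := by simp
  have hT := hD _ _ _ _ hr' ha hx
  have hnd := (h.cyc _ _ hr').nodup
  have hJ : ∀ y ∈ q ++ (s ++ [x', x]), arc D d z y → y = y₀ ∨ y = x := by
    intro y hy hd
    rcases List.mem_append.1 hy with hy | hy
    · left; exact E.tail h0 hy ⟨_, hd⟩
    · right
      rcases h.J hr' ha hx (by simp at hy ⊢; tauto) ⟨_, hd⟩ with rfl | rfl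
      · exfalso
        rw [List.append_assoc, List.nodup_cons, List.nodup_append] at hnd
        exact hnd.2.2.2 y (List.mem_of_head? hAa) y hy rfl
      · rfl
  have haZ : a ∈ Z := by
    rw [← hr'.mem_iff]; exact List.mem_cons_of_mem _ (List.mem_of_head? ha)
  rw [e, ← List.append_assoc] at hcy
  rw [← List.append_assoc] at hJ
  have c1 := C.F2r hcy (head_append_ne (head_append_ne h0)) st (hT d).2 hadj hJ
  have c2 := C.F2r (h.cyc _ _ hr') ha st (hT d).2 (hT d).1
    (fun y hy hd => h.J hr' ha hx hy ⟨_, hd⟩)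
  have := C.inj hz st hadj (hT d).1 (by rw [← c1, c2])
  exact (E.mem _ h0q).2 (this ▸ haZ)

end GB

namespace GB

open Relation

variable {D : Digr} {n : ℕ} {S : Finset ℕ}

/-- The bidirected case with adjacent ends. -/
lemma Ctx.ear_bid2 (C : Ctx D n S) {Z q l : List ℕ} {z z' : ℕ} (h : ICyc D S Z)
    (hD : Bid D Z) (E : MinEar D S Z z q z') (h4 : 4 ≤ Z.length)
    (hr : (z :: z' :: l) ~r Z) : False := by
  obtain ⟨s, b, x, rfl⟩ := two_le_decomp_last (l := l) (by
    have := hr.perm.length_eq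
    simp at this; omega)
  have hrx : (x :: z :: z' :: (s ++ [b])) ~r Z := by
    refine List.IsRotated.trans ?_ hr
    have := (List.isRotated_concat x (z :: z' :: (s ++ [b]))).symm
    simpa using this
  have hcx := h.cyc _ _ hrx
  have hlast : (z :: z' :: (s ++ [b])).getLast? = some b := by
    rw [← List.cons_append, ← List.cons_append, List.getLast?_concat]
  have hnd := hcx.nodup
  have hxz' : x ≠ z' := by rintro rfl; simp at hnd
  have hxZ : x ∈ Z := by rw [← hrx.mem_iff]; simp
  have hnxz' : ¬ Adj D x z' := by
    intro ha
    rcases h.J hrx rfl hlast (by simp) ha with e | e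
    · exact E.ne e.symm
    · subst e; simp at hnd
  have hnq : ∀ y ∈ q, ¬ Adj D x y := by
    intro y hy ha
    obtain ⟨A, F, rfl⟩ := List.append_of_mem hy
    have hc := E.chain
    rw [List.append_assoc, List.cons_append (bs := [z']), List.isChain_cons_split] at hc
    by_cases hA : A = []
    · subst hA
      by_cases hF : F = []
      · subst hF
        have E' : MinEar D S Z x [y] z' := by
          refine ⟨⟨hxZ, E.hz', hxz', by simp, E.mem, ?_⟩, E.min⟩
          have := hc.2
          simp at this ⊢
          exact ⟨ha, this⟩
        exact C.ear_bid1 h hD E' hnxz'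
      · have E' : Ear D S Z z [y] x := by
          refine ⟨E.hz, hxZ, ?_, by simp, ?_, ?_⟩
          · rintro rfl; simp at hnd
          · intro w hw; simp at hw; subst hw; exact E.mem _ (by simp)
          · have := hc.1
            simp at this ⊢
            exact ⟨this, ha.symm⟩
        have := E.min _ _ _ E'
        simp at this
        exact hF this
    · have E' : Ear D S Z x (y :: F) z' := by
        refine ⟨hxZ, E.hz', hxz', by simp, ?_, ?_⟩
        · intro w hw; apply E.mem; simp at hw ⊢; tauto
        · rw [List.cons_append, List.isChain_cons_cons]; exact ⟨ha, hc.2⟩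
      have := E.min _ _ _ E'
      simp at this
      exact hA this
  have hcy := E.toEar.cyc h E.nodup (A := []) hr
  have hcy2 := cyc_all hcy x (z :: (q ++ z' :: (s ++ [b]))) (by
    have := (List.isRotated_concat x (z :: (q ++ z' :: (s ++ [b])))).symm
    simpa using this)
  obtain ⟨y₀, q', rfl⟩ : ∃ y₀ q', q = y₀ :: q' := by
    cases hq : q with
    | nil => exact absurd hq E.qne
    | cons y t => exact ⟨y, t, rfl⟩
  obtain ⟨d, hadj⟩ := E.adj_head (y₀ := y₀) rfl
  have hxS : x ∈ S := hcx.mem x (by simp)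
  have hzS : z ∈ S := hcx.mem z (by simp)
  obtain ⟨φ, st⟩ := C.ex x hxS
  have hT := hD _ _ _ _ hrx rfl hlast
  have c1 : φ y₀ = φ b := by
    refine C.F2 hcy2 (d := d) ?_ st (hT d).2 (hT d).1 ?_
    · change (z :: y₀ :: (q' ++ z' :: (s ++ [b]))).getLast? = _
      rw [show z :: y₀ :: (q' ++ z' :: (s ++ [b])) = (z :: y₀ :: (q' ++ z' :: s)) ++ [b] by simp,
        List.getLast?_concat]
    · intro y hy hyd
      have hy' : y ∈ y₀ :: q' ∨ y ∈ z :: z' :: (s ++ [b]) := by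
        simp at hy ⊢; tauto
      rcases hy' with hy' | hy'
      · exact absurd ⟨_, hyd⟩ (hnq y hy')
      · exact h.J hrx rfl hlast hy' ⟨_, hyd⟩
  have c2 : φ z' = φ b := by
    refine C.F2 hcx hlast (d := d) st (hT d).2 (hT d).1 ?_
    intro y hy hyd
    exact h.J hrx rfl hlast hy ⟨_, hyd⟩
  have st' := C.move hxS st ⟨d, (hT d).1⟩
  have hTz := hD z (z' :: (s ++ [b, x])) z' x hr rfl (by
    rw [show z' :: (s ++ [b, x]) = (z' :: (s ++ [b])) ++ [x] by simp, List.getLast?_concat])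
  have hy₀ : y₀ ∉ Z := (E.mem y₀ (by simp)).2
  have hyx : y₀ ≠ x := by rintro rfl; exact hy₀ hxZ
  have := C.inj hzS st' hadj (hTz d).1 (by
    rw [Function.update_of_ne hyx, Function.update_of_ne hxz'.symm, c1, c2])
  subst this
  exact hy₀ E.hz'

lemma Ctx.ear_bid (C : Ctx D n S) {Z q : List ℕ} {z z' : ℕ} (h : ICyc D S Z)
    (hD : Bid D Z) (E : MinEar D S Z z q z') (h4 : 4 ≤ Z.length) : False := by
  by_cases ha : Adj D z z'
  · obtain ⟨l, hr⟩ := mem_rot E.hz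
    have : z' ∈ z :: l := by rw [hr.mem_iff]; exact E.hz'
    have hl : z' ∈ l := (List.mem_cons.1 this).resolve_left (fun e => E.ne e.symm)
    rcases h.ind z l hr z' hl ha with e | e
    · rcases l with _ | ⟨w, l⟩
      · simp at e
      · simp at e; subst e
        exact C.ear_bid2 h hD E h4 hr
    · obtain ⟨l', rfl⟩ : ∃ l', l = l' ++ [z'] := by
        rw [List.getLast?_eq_some_iff] at e; exact e
      have hr2 : (z' :: z :: l') ~r Z := by
        refine List.IsRotated.trans ?_ hr
        have := (List.isRotated_concat z' (z :: l')).symm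
        simpa using this
      exact C.ear_bid2 h hD E.rev h4 hr2
  · exact C.ear_bid1 h hD E ha

lemma Ctx.full_dir (C : Ctx D n S) {Z : List ℕ} {d : Bool} (h : ICyc D S Z)
    (hD : Dir D d Z) : ∀ s ∈ S, s ∈ Z := by
  intro s hs
  by_contra hc
  obtain ⟨z, q, z', E⟩ := exists_minEar (C.exists_ear h hs hc)
  exact C.ear_dir h hD E

lemma Ctx.full_bid (C : Ctx D n S) {Z : List ℕ} (h : ICyc D S Z)
    (hD : Bid D Z) (h4 : 4 ≤ Z.length) : ∀ s ∈ S, s ∈ Z := by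
  intro s hs
  by_contra hc
  obtain ⟨z, q, z', E⟩ := exists_minEar (C.exists_ear h hs hc)
  exact C.ear_bid h hD E h4

lemma tri_cyc {x y w : ℕ} (hx : x ∈ S) (hy : y ∈ S) (hw : w ∈ S) (h1 : Adj D x y)
    (h2 : Adj D y w) (h3 : Adj D w x) : ICyc D S [x, y, w] := by
  have hc : Cyc D S x [y, w] := by
    refine ⟨?_, ?_, ?_⟩
    · intro z hz; simp at hz; rcases hz with rfl | rfl | rfl <;> assumption
    · simp [h1.ne, h2.ne, h3.ne.symm]
    · simp [h1, h2, h3]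
  refine ⟨fun v l hr => cyc_all hc v l hr, by simp, ?_⟩
  intro v l hr z hz _
  have := hr.perm.length_eq
  match l, this with
  | [a, b], _ => simp at hz ⊢; rcases hz with rfl | rfl <;> simp

lemma Ctx.tri_bid (C : Ctx D n S) {s x y w : ℕ} (hx : x ∈ S) (hy : y ∈ S) (hw : w ∈ S)
    (h1 : Adj D x y) (h2 : Adj D y w) (h3 : Adj D w x) (hs : s ∈ S) (hn : s ∉ [x, y, w]) :
    ∀ e, arc D e x y ∧ arc D e x w := by
  have h := tri_cyc hx hy hw h1 h2 h3
  rcases C.classify h with ⟨d, hd⟩ | hb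
  · exact absurd (C.full_dir h hd s hs) hn
  · exact hb x [y, w] y w (List.IsRotated.refl _) rfl rfl

lemma Ctx.diamond (C : Ctx D n S) {v w u w' : ℕ} (hv : v ∈ S) (hw : w ∈ S) (hu : u ∈ S)
    (hw' : w' ∈ S) (h1 : Adj D v w) (h2 : Adj D v u) (h3 : Adj D v w') (h4 : Adj D w u)
    (h5 : Adj D u w') (hne : w ≠ w') (hna : ¬ Adj D w w') : False := by
  have t1 := C.tri_bid hw hv hu h1.symm h2 h4.symm hw' (by simp [hne.symm, h3.ne.symm, h5.ne.symm])
  have t2 := C.tri_bid hw' hv hu h3.symm h2 h5 hw (by simp [hne, h1.ne.symm, h4.ne])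
  obtain ⟨φ, st⟩ := C.ex w hw
  have hc : Cyc D S w [v, w', u] := by
    refine ⟨?_, ?_, ?_⟩
    · intro z hz; simp at hz; rcases hz with rfl | rfl | rfl | rfl <;> assumption
    · simp [h1.ne.symm, hne, h4.ne, h3.ne, h2.ne, h5.ne.symm]
    · simp [h1.symm, h3, h5.symm, h4.symm]
  have := C.F2 hc rfl st (t1 true).2 (t1 true).1 (by
    intro y hy hd
    simp at hy
    rcases hy with rfl | rfl | rfl
    · simp
    · exact absurd ⟨_, hd⟩ hna
    · simp)
  refine st u ?_
  have a1 := arc_true.1 (t2 true).2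
  have a2 := arc_false.1 (t2 false).2
  refine TransGen.head (b := w') ⟨?_, this.symm⟩ (TransGen.single ⟨?_, this⟩)
  · simp [Digr.delete, a2, hne.symm, h4.ne.symm]
  · simp [Digr.delete, a1, hne.symm, h4.ne.symm]

end GB

namespace GB

open Relation

variable {D : Digr} {n : ℕ} {S : Finset ℕ}

lemma Ctx.exists_cherry (C : Ctx D n S) {x y : ℕ} (hx : x ∈ S) (hy : y ∈ S) (hne : x ≠ y)
    (hna : ¬ Adj D x y) : ∃ v ∈ S, ∃ w ∈ S, ∃ w' ∈ S, Adj D v w ∧ Adj D v w' ∧ w ≠ w' ∧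
      ¬ Adj D w w' := by
  by_contra hcon
  push Not at hcon
  have : x = y ∨ Adj D x y := by
    have := C.conn x hx y hy
    clear hne hna hy
    induction this with
    | refl => left; rfl
    | tail _ h1 ih =>
      rename_i b c _
      rcases ih with rfl | ih
      · right; exact h1.2.2
      · by_cases hc : x = c
        · left; exact hc
        · right; exact hcon b h1.1 x hx c h1.2.1 ih.symm h1.2.2 hc
  exact this.elim hne hna

/-- A path joining two nonadjacent neighbors of `v`. -/
structure Det (D : Digr) (S : Finset ℕ) (v w w' : ℕ) (p : List ℕ) : Prop where
  hv : v ∈ S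
  hd : p.head? = some w
  lt : p.getLast? = some w'
  aw : Adj D v w
  aw' : Adj D v w'
  ne : w ≠ w'
  nadj : ¬ Adj D w w'
  vp : v ∉ p
  mem : ∀ y ∈ p, y ∈ S
  chain : List.IsChain (Adj D) p

/-- A shortest one. -/
structure MinDet (D : Digr) (S : Finset ℕ) (v w w' : ℕ) (p : List ℕ) : Prop
    extends Det D S v w w' p where
  min : ∀ a b c q, Det D S a b c q → p.length ≤ q.length

lemma Ctx.exists_det (C : Ctx D n S) {v w w' : ℕ} (hv : v ∈ S) (hw : w ∈ S) (hw' : w' ∈ S)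
    (h1 : Adj D v w) (h2 : Adj D v w') (hne : w ≠ w') (hna : ¬ Adj D w w') :
    ∃ p, Det D S v w w' p := by
  have key : ∃ p : List ℕ, p.head? = some w ∧ p.getLast? = some w' ∧ v ∉ p ∧ (∀ y ∈ p, y ∈ S) ∧
      List.IsChain (Adj D) p := by
    have := C.sep v hv w hw w' hw' h1.ne.symm h2.ne.symm
    clear h1 hne hna
    induction this using ReflTransGen.head_induction_on with
    | refl => exact ⟨[w'], rfl, rfl, by simpa using h2.ne, by simpa using hw', by simp⟩
    | head h3 _ ih =>
      rename_i x c _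
      obtain ⟨p, e1, e2, e3, e4, e5⟩ := ih h3.2.1.1
      rcases p with _ | ⟨c', p⟩
      · simp at e1
      · simp at e1; subst e1
        refine ⟨x :: c' :: p, rfl, by rw [List.getLast?_cons_cons]; exact e2, ?_, ?_, ?_⟩
        · rw [List.mem_cons, not_or]; exact ⟨h3.1.2.symm, e3⟩
        · intro y hy
          rcases List.mem_cons.1 hy with rfl | hy
          · exact h3.1.1
          · exact e4 y hy
        · rw [List.isChain_cons_cons]; exact ⟨h3.2.2, e5⟩
  obtain ⟨p, e1, e2, e3, e4, e5⟩ := key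
  exact ⟨p, hv, e1, e2, h1, h2, hne, hna, e3, e4, e5⟩

lemma exists_minDet (h : ∃ v w w' p, Det D S v w w' p) : ∃ v w w' p, MinDet D S v w w' p := by
  classical
  have hP : ∃ m, ∃ v w w' p, Det D S v w w' p ∧ p.length = m := by
    obtain ⟨v, w, w', p, E⟩ := h; exact ⟨_, v, w, w', p, E, rfl⟩
  obtain ⟨v, w, w', p, E, e⟩ := Nat.find_spec hP
  refine ⟨v, w, w', p, E, fun a b c q E' => ?_⟩
  rw [e]
  exact Nat.find_min' hP ⟨a, b, c, q, E', rfl⟩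

lemma getLast_congr {A B E : List ℕ} {y : ℕ} :
    (A ++ y :: E).getLast? = (B ++ y :: E).getLast? := by
  rw [List.getLast?_append_of_ne_nil _ (by simp), List.getLast?_append_of_ne_nil _ (by simp)]

lemma head_congr {A E F : List ℕ} {y : ℕ} :
    (A ++ y :: E).head? = (A ++ y :: F).head? := by
  simp [List.head?_append]

lemma MinDet.nodup {v w w' : ℕ} {p : List ℕ} (M : MinDet D S v w w' p) : p.Nodup := by
  by_contra hcon
  obtain ⟨A, y, B, F, rfl⟩ := dup_decomp hcon
  have hc := M.chain
  rw [List.isChain_split, List.isChain_cons_split] at hc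
  have : Det D S v w w' (A ++ y :: F) := by
    refine ⟨M.hv, ?_, ?_, M.aw, M.aw', M.ne, M.nadj, ?_, ?_, ?_⟩
    · rw [← M.hd]; exact head_congr
    · rw [← M.lt, show A ++ y :: (B ++ y :: F) = (A ++ y :: B) ++ y :: F by simp]
      exact getLast_congr
    · have := M.vp; simp at this ⊢; tauto
    · intro z hz; apply M.mem; simp at hz ⊢; tauto
    · rw [List.isChain_split]; exact ⟨hc.1, hc.2.2⟩
  have := M.min _ _ _ _ this
  simp at this; omega

lemma MinDet.ind {v w w' u t : ℕ} {A B G : List ℕ}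
    (M : MinDet D S v w w' (A ++ u :: (B ++ t :: G))) (ha : Adj D u t) : B = [] := by
  by_contra hB
  have hc := M.chain
  rw [List.isChain_split, List.isChain_cons_split] at hc
  have : Det D S v w w' (A ++ u :: t :: G) := by
    refine ⟨M.hv, ?_, ?_, M.aw, M.aw', M.ne, M.nadj, ?_, ?_, ?_⟩
    · rw [← M.hd]; exact head_congr
    · rw [← M.lt, show A ++ u :: (B ++ t :: G) = (A ++ u :: B) ++ t :: G by simp,
        show A ++ u :: t :: G = (A ++ [u]) ++ t :: G by simp]
      exact getLast_congr
    · have := M.vp; simp at this ⊢; tauto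
    · intro z hz; apply M.mem; simp at hz ⊢; tauto
    · rw [List.isChain_split, List.isChain_cons_cons]; exact ⟨hc.1, ha, hc.2.2⟩
  have := M.min _ _ _ _ this
  simp at this
  exact hB this

lemma Ctx.det_int (C : Ctx D n S) {v w w' u : ℕ} {A F : List ℕ}
    (M : MinDet D S v w w' (A ++ u :: F)) (ha : Adj D v u) (hA : A ≠ []) (hF : F ≠ []) :
    False := by
  have hc := M.chain
  rw [List.isChain_split] at hc
  have hnd := M.nodup
  have hw : w ∈ A := by
    rcases A with _ | ⟨a, A⟩
    · exact absurd rfl hA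
    · have := M.hd; simp at this; simp [this]
  have hw' : w' ∈ F := by
    have := M.lt
    rcases F.eq_nil_or_concat with rfl | ⟨F', b, rfl⟩
    · exact absurd rfl hF
    · rw [List.concat_eq_append] at this ⊢
      rw [show A ++ u :: (F' ++ [b]) = (A ++ u :: F') ++ [b] by simp, List.getLast?_concat] at this
      cases this; simp
  rw [List.nodup_append, List.nodup_cons] at hnd
  have hwu : w ≠ u := hnd.2.2 w hw u (by simp)
  have huw' : u ≠ w' := by rintro rfl; exact hnd.2.1.1 hw'
  have h1 : Adj D w u := by
    by_contra hn
    have : Det D S v w u (A ++ [u]) := by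
      refine ⟨M.hv, ?_, by simp, M.aw, ha, hwu, hn, ?_, ?_, hc.1⟩
      · rw [← M.hd]; exact head_congr
      · have := M.vp; simp at this ⊢; tauto
      · intro z hz; apply M.mem; simp at hz ⊢; tauto
    have := M.min _ _ _ _ this
    simp at this
    exact hF this
  have h2 : Adj D u w' := by
    by_contra hn
    have : Det D S v u w' (u :: F) := by
      refine ⟨M.hv, rfl, ?_, ha, M.aw', huw', hn, ?_, ?_, hc.2⟩
      · rw [← M.lt]; exact getLast_congr (A := [])
      · have := M.vp; simp at this ⊢; tauto
      · intro z hz; apply M.mem; simp at hz ⊢; tauto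
    have := M.min _ _ _ _ this
    simp at this
    exact hA this
  exact C.diamond M.hv (M.mem w (by simp [hw])) (M.mem u (by simp)) (M.mem w' (by simp [hw']))
    M.aw ha M.aw' h1 h2 M.ne M.nadj

lemma rot_cases {u v : ℕ} {l p : List ℕ} (h : (u :: l) ~r (v :: p)) :
    (u = v ∧ l = p) ∨ ∃ A F, p = A ++ u :: F ∧ l = F ++ v :: A := by
  obtain ⟨m, hm, e⟩ := List.isRotated_iff_mod.1 h.symm
  rw [List.rotate_eq_drop_append_take hm] at e
  rcases m with _ | m
  · simp at e; left; exact ⟨e.1.symm, e.2.symm⟩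
  · simp only [List.drop_succ_cons, List.take_succ_cons] at e
    have ep := List.take_append_drop m p
    generalize p.take m = A at e ep
    generalize p.drop m = B at e ep
    rcases B with _ | ⟨b, F⟩
    · simp at e ep; left; exact ⟨e.1.symm, by rw [← e.2, ep]⟩
    · simp at e; right
      exact ⟨A, F, by rw [← ep, e.1], e.2.symm⟩

lemma Ctx.det_icyc (C : Ctx D n S) {v w w' : ℕ} {p : List ℕ} (M : MinDet D S v w w' p) :
    ICyc D S (v :: p) ∧ 4 ≤ (v :: p).length := by
  have hlen : 3 ≤ p.length := by
    have h1 := M.hd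
    have h2 := M.lt
    have h3 := M.chain
    match p, h1, h2, h3 with
    | [], h1, _, _ => simp at h1
    | [a], h1, h2, _ => simp at h1 h2; exact absurd (h1.symm.trans h2) M.ne
    | [a, b], h1, h2, h3 =>
      simp at h1 h2 h3; subst h1 h2; exact absurd h3 M.nadj
    | _ :: _ :: _ :: _, _, _, _ => simp
  have hc : Cyc D S v p := by
    refine ⟨?_, List.nodup_cons.2 ⟨M.vp, M.nodup⟩, ?_⟩
    · intro x hx
      rcases List.mem_cons.1 hx with rfl | hx
      · exact M.hv
      · exact M.mem x hx
    · rw [List.isChain_cons, List.isChain_append]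
      refine ⟨?_, M.chain, by simp, ?_⟩
      · intro y hy
        rw [head_append_ne M.hd] at hy
        cases hy; exact M.aw
      · intro x hx y hy
        rw [M.lt] at hx; simp at hy hx; subst hx hy
        exact M.aw'.symm
  refine ⟨⟨fun u l hr => cyc_all hc u l hr, by simp; omega, ?_⟩, by simp; omega⟩
  intro u l hr x hx ha
  rcases rot_cases hr with ⟨rfl, rfl⟩ | ⟨A, F, rfl, rfl⟩
  · obtain ⟨A, F, rfl⟩ := List.append_of_mem hx
    by_cases hA : A = []
    · subst hA; left; rfl
    · by_cases hF : F = []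
      · subst hF; right; simp
      · exact (C.det_int M ha hA hF).elim
  · rcases List.mem_append.1 hx with hx | hx
    · obtain ⟨B, G, rfl⟩ := List.append_of_mem hx
      have := M.ind ha
      subst this
      left; rfl
    · rcases List.mem_cons.1 hx with rfl | hx
      · by_cases hF : F = []
        · subst hF; left; rfl
        · by_cases hA : A = []
          · subst hA; right; simp
          · exact (C.det_int M ha.symm hA hF).elim
      · obtain ⟨G, B, rfl⟩ := List.append_of_mem hx
        rw [List.append_assoc, List.cons_append] at M
        have := M.ind ha.symm
        subst this
        right
        rw [show F ++ v :: (G ++ [x]) = (F ++ v :: G) ++ [x] by simp, List.getLast?_concat]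

lemma rot_at {Z : List ℕ} (h3 : 3 ≤ Z.length) {i : ℕ} (hi : i < Z.length) :
    ∃ l, (Z.getD i 0 :: l) ~r Z ∧ l.head? = some (Z.getD ((i + 1) % Z.length) 0) ∧
      l.getLast? = some (Z.getD ((i + (Z.length - 1)) % Z.length) 0) := by
  have hN : 0 < Z.length := by omega
  have hg : ∀ j (hj : j < Z.length),
      (Z.rotate i)[j]? = some (Z.getD ((i + j) % Z.length) 0) := by
    intro j hj
    rw [List.getElem?_eq_getElem (by simpa using hj), List.getElem_rotate, List.getD_eq_getElem _ _ (Nat.mod_lt _ hN)]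
    congr 3; omega
  have hl : (Z.rotate i).length = Z.length := by simp
  have hr : Z.rotate i ~r Z := List.IsRotated.forall _ _
  have h0 := hg 0 hN
  have h1 := hg 1 (by omega)
  have h2 := hg (Z.length - 1) (by omega)
  rw [Nat.add_zero, Nat.mod_eq_of_lt hi] at h0
  generalize Z.rotate i = Y at *
  match Y, hl with
  | y :: l, hl =>
    simp at hl
    refine ⟨l, by rw [← Option.some.inj h0]; exact hr, ?_, ?_⟩
    · rw [← h1]
      rcases l with _ | ⟨b, l⟩
      · simp at hl; omega
      · simp
    · rw [← h2, List.getLast?_eq_getElem?, ← hl]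
      rcases l with _ | ⟨b, l⟩
      · simp at hl; omega
      · simp

lemma ICyc.nodup {Z : List ℕ} (h : ICyc D S Z) : Z.Nodup := by
  have h3 := h.len
  match Z, h3 with
  | v :: l, _ => exact (h.cyc v l (List.IsRotated.refl _)).nodup

lemma ICyc.sub {Z : List ℕ} (h : ICyc D S Z) : ∀ z ∈ Z, z ∈ S := by
  intro z hz
  obtain ⟨l, hl⟩ := mem_rot hz
  exact (h.cyc z l hl).mem z (by simp)

lemma injOn_getD {Z : List ℕ} (h : Z.Nodup) :
    Set.InjOn (fun i => Z.getD i 0) ↑(Finset.range Z.length) := by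
  intro i hi j hj e
  simp at hi hj
  simp only [List.getD_eq_getElem _ _ hi, List.getD_eq_getElem _ _ hj] at e
  exact (List.Nodup.getElem_inj_iff h).1 e

lemma mem_getD {Z : List ℕ} {x : ℕ} (h : x ∈ Z) : ∃ i < Z.length, Z.getD i 0 = x := by
  obtain ⟨i, hi, e⟩ := List.mem_iff_getElem.1 h
  exact ⟨i, hi, by rw [List.getD_eq_getElem _ _ hi, e]⟩

lemma getD_mem {Z : List ℕ} {i : ℕ} (h : i < Z.length) : Z.getD i 0 ∈ Z := by
  rw [List.getD_eq_getElem _ _ h]; exact List.getElem_mem h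

lemma verts_eq {Z : List ℕ} (h : ICyc D S Z) (hf : ∀ s ∈ S, s ∈ Z) :
    S = (Finset.range Z.length).image (fun i => Z.getD i 0) := by
  ext x
  simp only [Finset.mem_image, Finset.mem_range]
  constructor
  · intro hx; exact mem_getD (hf x hx)
  · rintro ⟨i, hi, rfl⟩; exact h.sub _ (getD_mem hi)

lemma Dir.isDirCycle {Z : List ℕ} {B : Digr} (h : ICyc D B.verts Z) (hd : Dir D true Z)
    (hf : ∀ s ∈ B.verts, s ∈ Z)
    (hB : ∀ x y, (x, y) ∈ B.arcs ↔ x ∈ B.verts ∧ y ∈ B.verts ∧ (x, y) ∈ D.arcs) :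
    B.IsDirCycle := by
  have h3 := h.len
  have hN : 0 < Z.length := by omega
  refine ⟨Z.length, fun i => Z.getD i 0, by omega, injOn_getD h.nodup, verts_eq h hf, ?_⟩
  ext ⟨x, y⟩
  simp only [Finset.mem_image, Finset.mem_range, Prod.mk.injEq]
  rw [hB]
  constructor
  · rintro ⟨hx, hy, ha⟩
    obtain ⟨i, hi, rfl⟩ := mem_getD (hf x hx)
    refine ⟨i, hi, rfl, ?_⟩
    obtain ⟨l, hr, e1, e2⟩ := rot_at h3 hi
    have hT := hd _ _ _ _ hr e1 e2
    have ha' := arc_true.2 ha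
    have hyl : y ∈ l := by
      have := hr.mem_iff.2 (hf y hy)
      exact (List.mem_cons.1 this).resolve_left (arc_ne ha').symm
    rcases h.J hr e1 e2 hyl ⟨_, ha'⟩ with e | e
    · exact e.symm
    · subst e; exact absurd ha' hT.2.1
  · rintro ⟨i, hi, rfl, rfl⟩
    refine ⟨h.sub _ (getD_mem hi), h.sub _ (getD_mem (Nat.mod_lt _ hN)), ?_⟩
    obtain ⟨l, hr, e1, e2⟩ := rot_at h3 hi
    exact arc_true.1 (hd _ _ _ _ hr e1 e2).1

lemma rot_rev {Z l : List ℕ} {v : ℕ} (h : (v :: l) ~r Z.reverse) : (v :: l.reverse) ~r Z := by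
  have := h.reverse
  rw [List.reverse_reverse, List.reverse_cons] at this
  exact (List.isRotated_concat v l.reverse).symm.trans this

lemma ICyc.reverse {Z : List ℕ} (h : ICyc D S Z) : ICyc D S Z.reverse := by
  refine ⟨?_, by simpa using h.len, ?_⟩
  · intro v l hr
    have := (h.cyc _ _ (rot_rev hr)).rev
    simpa using this
  · intro v l hr x hx ha
    have := h.ind _ _ (rot_rev hr) x (by simpa using hx) ha
    simpa [or_comm] using this

lemma Dir.reverse {Z : List ℕ} (h : Dir D false Z) : Dir D true Z.reverse := by
  intro v l a x hr ha hx
  have := h _ _ x a (rot_rev hr) (by simpa using hx) (by simpa using ha)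
  simp only [TA, Bool.not_false, Bool.not_true] at this ⊢
  tauto

lemma Dir.isDirCycle' {Z : List ℕ} {B : Digr} {d : Bool} (h : ICyc D B.verts Z) (hd : Dir D d Z)
    (hf : ∀ s ∈ B.verts, s ∈ Z)
    (hB : ∀ x y, (x, y) ∈ B.arcs ↔ x ∈ B.verts ∧ y ∈ B.verts ∧ (x, y) ∈ D.arcs) :
    B.IsDirCycle := by
  cases d with
  | true => exact hd.isDirCycle h hf hB
  | false => exact (Dir.reverse hd).isDirCycle h.reverse (by simpa using hf) hB

lemma Bid.isBidirCycle {Z : List ℕ} {B : Digr} (h : ICyc D B.verts Z) (hd : Bid D Z)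
    (hf : ∀ s ∈ B.verts, s ∈ Z)
    (hB : ∀ x y, (x, y) ∈ B.arcs ↔ x ∈ B.verts ∧ y ∈ B.verts ∧ (x, y) ∈ D.arcs) :
    B.IsBidirCycle Z.length := by
  have h3 := h.len
  have hN : 0 < Z.length := by omega
  refine ⟨fun i => Z.getD i 0, injOn_getD h.nodup, verts_eq h hf, ?_⟩
  ext ⟨x, y⟩
  simp only [Finset.mem_union, Finset.mem_image, Finset.mem_range, Prod.mk.injEq]
  rw [hB]
  constructor
  · rintro ⟨hx, hy, ha⟩
    obtain ⟨i, hi, rfl⟩ := mem_getD (hf x hx)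
    obtain ⟨l, hr, e1, e2⟩ := rot_at h3 hi
    have ha' := arc_true.2 ha
    have hyl : y ∈ l := by
      have := hr.mem_iff.2 (hf y hy)
      exact (List.mem_cons.1 this).resolve_left (arc_ne ha').symm
    rcases h.J hr e1 e2 hyl ⟨_, ha'⟩ with e | e
    · left; exact ⟨i, hi, rfl, e.symm⟩
    · right
      refine ⟨_, Nat.mod_lt _ hN, ?_, e.symm⟩
      congr 1
      rw [Nat.mod_add_mod, show i + (Z.length - 1) + 1 = i + Z.length by omega,
        Nat.add_mod_right, Nat.mod_eq_of_lt hi]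
  · rintro (⟨i, hi, rfl, rfl⟩ | ⟨i, hi, rfl, rfl⟩)
    · refine ⟨h.sub _ (getD_mem hi), h.sub _ (getD_mem (Nat.mod_lt _ hN)), ?_⟩
      obtain ⟨l, hr, e1, e2⟩ := rot_at h3 hi
      exact arc_true.1 (hd _ _ _ _ hr e1 e2 true).1
    · refine ⟨h.sub _ (getD_mem (Nat.mod_lt _ hN)), h.sub _ (getD_mem hi), ?_⟩
      obtain ⟨l, hr, e1, e2⟩ := rot_at h3 hi
      exact arc_false.1 (hd _ _ _ _ hr e1 e2 false).1

lemma Ctx.odd (C : Ctx D n S) {Z : List ℕ} (h : ICyc D S Z) (hd : Bid D Z) : Odd Z.length := by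
  have h3 := h.len
  obtain ⟨l, hr, e1, e2⟩ := rot_at h3 (i := 0) (by omega)
  have hT := hd _ _ _ _ hr e1 e2 true
  have := C.parity h hr e1 e2 hT.1 hT.2
  rw [← hr.perm.length_eq, List.length_cons]
  exact this.add_one

theorem main {B : Digr} (C : Ctx D n B.verts)
    (hB : ∀ x y, (x, y) ∈ B.arcs ↔ x ∈ B.verts ∧ y ∈ B.verts ∧ (x, y) ∈ D.arcs) :
    (∃ x y : ℕ, x ≠ y ∧ B.verts = {x, y} ∧ B.arcs = {(x, y)}) ∨
    B.IsDirCycle ∨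
    (∃ n : ℕ, Odd n ∧ 3 ≤ n ∧ B.IsBidirCycle n) ∨
    B.IsBidirComplete := by
  by_cases hdir : ∃ Z d, ICyc D B.verts Z ∧ Dir D d Z
  · obtain ⟨Z, d, h, hd⟩ := hdir
    right; left
    exact hd.isDirCycle' h (C.full_dir h hd) hB
  have hbid : ∀ Z, ICyc D B.verts Z → Bid D Z := by
    intro Z h
    rcases C.classify h with ⟨d, hd⟩ | hb
    · exact absurd ⟨Z, d, h, hd⟩ hdir
    · exact hb
  by_cases hcomp : ∃ x ∈ B.verts, ∃ y ∈ B.verts, x ≠ y ∧ ¬ Adj D x y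
  · obtain ⟨x, hx, y, hy, hne, hna⟩ := hcomp
    obtain ⟨v, hv, w, hw, w', hw', a1, a2, a3, a4⟩ := C.exists_cherry hx hy hne hna
    obtain ⟨p, hp⟩ := C.exists_det hv hw hw' a1 a2 a3 a4
    obtain ⟨v, w, w', p, M⟩ := exists_minDet ⟨v, w, w', p, hp⟩
    obtain ⟨h, h4⟩ := C.det_icyc M
    have hb := hbid _ h
    right; right; left
    exact ⟨_, C.odd h hb, h.len, hb.isBidirCycle h (C.full_bid h hb h4) hB⟩
  push Not at hcomp
  by_cases hall : ∀ x ∈ B.verts, ∀ y ∈ B.verts, x ≠ y → (x, y) ∈ D.arcs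
  · right; right; right
    ext ⟨x, y⟩
    simp only [Finset.mem_filter, Finset.mem_product]
    rw [hB]
    constructor
    · rintro ⟨hx, hy, ha⟩; exact ⟨⟨hx, hy⟩, D.no_loops _ ha⟩
    · rintro ⟨⟨hx, hy⟩, hne⟩; exact ⟨hx, hy, hall x hx y hy hne⟩
  · push Not at hall
    obtain ⟨x, hx, y, hy, hne, hna⟩ := hall
    have hxy : ∀ w ∈ B.verts, w = y ∨ w = x := by
      intro w hw
      by_contra hcon
      push Not at hcon
      have h := tri_cyc hx hy hw (hcomp x hx y hy hne) (hcomp y hy w hw hcon.1.symm)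
        (hcomp w hw x hx hcon.2)
      exact hna (arc_true.1 (hbid _ h x [y, w] y w (List.IsRotated.refl _) rfl rfl true).1)
    have hyx : (y, x) ∈ D.arcs := (adj_iff.1 (hcomp x hx y hy hne)).resolve_left hna
    left
    refine ⟨y, x, hne.symm, ?_, ?_⟩
    · ext w
      simp only [Finset.mem_insert, Finset.mem_singleton]
      exact ⟨hxy w, by rintro (rfl | rfl) <;> assumption⟩
    · ext ⟨a, b⟩
      simp only [Finset.mem_singleton, Prod.mk.injEq]
      rw [hB]
      constructor
      · rintro ⟨ha, hb, hab⟩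
        have := D.no_loops _ hab
        rcases hxy a ha with rfl | rfl <;> rcases hxy b hb with rfl | rfl
        · exact absurd rfl this
        · exact ⟨rfl, rfl⟩
        · exact absurd hab hna
        · exact absurd rfl this
      · rintro ⟨rfl, rfl⟩; exact ⟨hy, hx, hyx⟩

end GB

namespace GB

open Relation Digr

lemma colorable_mono {D : Digr} {m n : ℕ} (h : D.Colorable m) (hmn : m ≤ n) :
    D.Colorable n := by
  obtain ⟨φ, hφ⟩ := h
  refine ⟨fun x => Fin.castLE hmn (φ x), fun v t => hφ v ?_⟩
  refine TransGen.mono ?_ _ _ t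
  rintro x y ⟨h1, h2⟩
  exact ⟨h1, Fin.castLE_injective hmn h2⟩

lemma colorable_some (D : Digr) : ∃ n, D.Colorable n := by
  refine ⟨D.verts.sup id + 1, fun x => Fin.ofNat _ x, ?_⟩
  intro v t
  have : ∀ x y, ((x, y) ∈ D.arcs ∧
      (Fin.ofNat (D.verts.sup id + 1) x = Fin.ofNat (D.verts.sup id + 1) y)) → False := by
    rintro x y ⟨h1, h2⟩
    have hs := D.arcs_sub _ h1
    have hx : x ≤ D.verts.sup id := Finset.le_sup (f := id) hs.1
    have hy : y ≤ D.verts.sup id := Finset.le_sup (f := id) hs.2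
    have := congrArg Fin.val h2
    simp only [Fin.val_ofNat] at this
    rw [Nat.mod_eq_of_lt (by omega), Nat.mod_eq_of_lt (by omega)] at this
    exact D.no_loops _ h1 this
  cases t with
  | single h => exact this _ _ h
  | tail _ h => exact this _ _ h

lemma colorable_of_dichrom {D : Digr} {n : ℕ} (h : D.dichrom ≤ n) : D.Colorable n :=
  colorable_mono (Nat.sInf_mem (s := {n | D.Colorable n}) (colorable_some D)) h

lemma block_arcs {B L : Digr} (hB : IsBlock B L) (x y : ℕ) :
    (x, y) ∈ B.arcs ↔ x ∈ B.verts ∧ y ∈ B.verts ∧ (x, y) ∈ L.arcs := by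
  obtain ⟨hs, hc, hn, hm⟩ := hB
  have hsub : B.Sub (L.induce B.verts) := by
    constructor
    · intro v hv
      exact Finset.mem_inter.2 ⟨hs.1 hv, hv⟩
    · intro a ha
      exact Finset.mem_filter.2 ⟨hs.2 ha, B.arcs_sub a ha⟩
  have hv : (L.induce B.verts).verts = B.verts := Finset.inter_eq_right.2 hs.1
  have := hm (L.induce B.verts) ?_ ?_ ?_ hsub
  · constructor
    · intro h
      exact ⟨(B.arcs_sub _ h).1, (B.arcs_sub _ h).2, hs.2 h⟩
    · rintro ⟨h1, h2, h3⟩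
      rw [← this]
      exact Finset.mem_filter.2 ⟨h3, h1, h2⟩
  · exact ⟨Finset.inter_subset_left, Finset.filter_subset _ _⟩
  · intro x hx y hy
    rw [hv] at hx hy
    refine ReflTransGen.mono ?_ _ _ (hc x hx y hy)
    intro a b h
    exact h.imp (fun h => hsub.2 h) (fun h => hsub.2 h)
  · intro v hvv x hx y hy
    rw [hv] at hvv
    have hx' : x ∈ (B.delete v).verts := by
      simp only [delete, hv] at hx ⊢; exact hx
    have hy' : y ∈ (B.delete v).verts := by
      simp only [delete, hv] at hy ⊢; exact hy
    refine ReflTransGen.mono ?_ _ _ (hn v hvv x hx' y hy')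
    have : (B.delete v).arcs ⊆ ((L.induce B.verts).delete v).arcs :=
      Finset.filter_subset_filter _ hsub.2
    intro a b h
    exact h.imp (fun h => this h) (fun h => this h)

lemma block_ctx {k : ℕ} {D B : Digr} (hD : D.Critical k) {v₀ : ℕ} (hv₀ : v₀ ∈ B.verts)
    (hB : IsBlock B (D.induce (D.lowVerts k))) : Ctx D (k - 1) B.verts := by
  have hlow : ∀ v ∈ B.verts, v ∈ D.lowVerts k := fun v hv => (Finset.mem_inter.1 (hB.1.1 hv)).2
  have hDv : ∀ v ∈ B.verts, v ∈ D.verts := fun v hv => (Finset.mem_inter.1 (hB.1.1 hv)).1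
  have hBD : ∀ a ∈ B.arcs, a ∈ D.arcs := fun a ha => (Finset.mem_filter.1 (hB.1.2 ha)).1
  have hdel : ∀ v ∈ B.verts, (D.delete v).dichrom < k := by
    intro v hv
    refine hD.2 _ ⟨Finset.erase_subset _ _, Finset.filter_subset _ _⟩ ?_
    intro e
    have := hDv v hv
    rw [← e] at this
    exact (Finset.mem_erase.1 this).1 rfl
  have hk : 1 ≤ k := by have := hdel v₀ hv₀; omega
  refine ⟨?_, ?_, ?_, ?_, ?_⟩
  · intro hc
    have : D.dichrom ≤ k - 1 := Nat.sInf_le hc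
    rw [hD.1] at this; omega
  · intro v hv
    exact (Finset.mem_filter.1 (hlow v hv)).2
  · intro v hv
    exact colorable_of_dichrom (by have := hdel v hv; omega)
  · intro x hx y hy
    refine ReflTransGen.mono ?_ _ _ (hB.2.1 x hx y hy)
    rintro a b (h | h)
    · exact ⟨(B.arcs_sub _ h).1, (B.arcs_sub _ h).2, adj_iff.2 (Or.inl (hBD _ h))⟩
    · exact ⟨(B.arcs_sub _ h).2, (B.arcs_sub _ h).1, adj_iff.2 (Or.inr (hBD _ h))⟩
  · intro v hv x hx y hy hxv hyv
    refine ReflTransGen.mono ?_ _ _ (hB.2.2.1 v hv x (Finset.mem_erase.2 ⟨hxv, hx⟩) y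
      (Finset.mem_erase.2 ⟨hyv, hy⟩))
    rintro a b (h | h)
    · obtain ⟨h, h1, h2⟩ := Finset.mem_filter.1 h
      exact ⟨⟨(B.arcs_sub _ h).1, h1⟩, ⟨(B.arcs_sub _ h).2, h2⟩, adj_iff.2 (Or.inl (hBD _ h))⟩
    · obtain ⟨h, h1, h2⟩ := Finset.mem_filter.1 h
      exact ⟨⟨(B.arcs_sub _ h).2, h2⟩, ⟨(B.arcs_sub _ h).1, h1⟩, adj_iff.2 (Or.inr (hBD _ h))⟩

end GB


open Digr in
/-- Let `D` be a `k`-critical digraph and `D_L` the subdigraph of `D`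
induced by the vertices of out-degree and in-degree `k - 1`. Then every block `B` of
`D_L` is a single arc, a directed cycle of length ≥ 2, a bidirected cycle of odd
length, or a bidirected complete graph. -/
theorem gallai_blocks (k : ℕ) (D : Digr) (hD : D.Critical k)
    (B : Digr) (hB : IsBlock B (D.induce (D.lowVerts k))) :
    (∃ x y : ℕ, x ≠ y ∧ B.verts = {x, y} ∧ B.arcs = {(x, y)}) ∨
    B.IsDirCycle ∨
    (∃ n : ℕ, Odd n ∧ 3 ≤ n ∧ B.IsBidirCycle n) ∨
    B.IsBidirComplete := by
  rcases B.verts.eq_empty_or_nonempty with he | ⟨v, hv⟩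
  · right; right; right
    have ha : B.arcs = ∅ := by
      ext a
      simp only [Finset.notMem_empty, iff_false]
      intro h
      have := (B.arcs_sub a h).1
      rw [he] at this
      simp at this
    simp [Digr.IsBidirComplete, he, ha]
  · refine GB.main (GB.block_ctx hD hv hB) ?_
    intro x y
    rw [GB.block_arcs hB]
    constructor
    · rintro ⟨h1, h2, h3⟩
      exact ⟨h1, h2, (Finset.mem_filter.1 h3).1⟩
    · rintro ⟨h1, h2, h3⟩
      exact ⟨h1, h2, Finset.mem_filter.2 ⟨h3, (Finset.mem_inter.1 (hB.1.1 h1)).2,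
        (Finset.mem_inter.1 (hB.1.1 h2)).2⟩⟩
end
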